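/- For positive integers k₁,…,k_d, the identity (-1)^d ζ^{⋆,*}(k₁,…,k_d) − (-1)^{k₁+⋯+k_d} ζ^*(k₁,…,k_d) = −∑_{i=0}^{d-1} (-1)^i ζ^{⋆,*}(k₁,…,k_i) δ^{k_{i+1},…,k_d} + ∑_{0≤i<j≤d} ∑_{a+2m+b=k_j, a,b,m≥0} (-1)^{i+b+k_{j+1}+⋯+k_d+m} (2π)^{2m} B_{2m}/(2m)! · ζ^{⋆,*}(k₁,…,k_i) ζ_a^*(k_{j-1},…,k_{i+1}) ζ_b^*(k_{j+1},…,k_d) holds. -/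

import Mathlib

open scoped BigOperators
open Real

/-- The multiple zeta value `ζ(k₁,…,k_d) = ∑_{0<m₁<⋯<m_d} ∏ 1/m_i^{k_i}`
(as a `tsum` over strictly increasing tuples of positive integers). -/
noncomputable def MZV (k : List ℕ) : ℝ :=
  ∑' m : {f : Fin k.length → ℕ+ // StrictMono f}, ∏ i, 1 / ((m.1 i : ℕ) : ℝ) ^ k.get i

/-- The stuffle (quasi-shuffle) product of two words, as a multiset of words. -/
def stuffle : List ℕ → List ℕ → Multiset (List ℕ)
  | [], v => {v}
  | u, [] => {u}
  | a :: u, b :: v =>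
      (stuffle u (b :: v)).map (a :: ·) + (stuffle (a :: u) v).map (b :: ·) +
        (stuffle u v).map ((a + b) :: ·)
  termination_by u v => u.length + v.length

/-- All contractions of a word: the results of replacing each comma by `,` or `+`. -/
def contractions : List ℕ → Multiset (List ℕ)
  | [] => {[]}
  | [a] => {[a]}
  | a :: b :: t => (contractions (b :: t)).map (a :: ·) + contractions ((a + b) :: t)
  termination_by l => l.length

/-- `Z` is a stuffle (harmonic) regularization of multiple zeta values:
it takes the value `1` on the empty word, agrees with the convergent multiple zeta
values on admissible words, and is a homomorphism for the stuffle product. -/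
structure IsStuffleReg (Z : List ℕ → ℝ) : Prop where
  empty : Z [] = 1
  conv : ∀ l : List ℕ, (∀ i ∈ l, 0 < i) → 2 ≤ l.getLastD 2 → Z l = MZV l
  mul : ∀ u v : List ℕ, (∀ i ∈ u, 0 < i) → (∀ i ∈ v, 0 < i) →
    Z u * Z v = ((stuffle u v).map Z).sum

/-- The star version `ζ^{⋆,*}(k₁,…,k_d)`: the sum of `Z` over all contractions. -/
noncomputable def zetaStarOf (Z : List ℕ → ℝ) (l : List ℕ) : ℝ :=
  ((contractions l).map Z).sum

/-- `ζ_a^*(l₁,…,l_r) = (-1)^a ∑_{a₁+⋯+a_r=a} ζ^*(l₁+a₁,…,l_r+a_r) ∏ C(l_i-1+a_i,a_i)`. -/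
noncomputable def zetaA (Z : List ℕ → ℝ) (a : ℕ) (l : List ℕ) : ℝ :=
  (-1 : ℝ) ^ a *
    ∑ f ∈ (Fintype.piFinset fun _ : Fin l.length => Finset.range (a + 1)).filter
        (fun f => ∑ i, f i = a),
      Z (List.ofFn fun i => l.get i + f i) *
        ∏ i, (Nat.choose (l.get i - 1 + f i) (f i) : ℝ)

/-- `δ^{k₁,…,k_d}`: equal to `(-1)^n π^{2n}/(2n)!` if `(k₁,…,k_d) = (1,…,1)` has even
length `2n`, and `0` otherwise. -/
noncomputable def deltaVal (l : List ℕ) : ℝ :=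
  if l.all (· = 1) ∧ l.length % 2 = 0 then
    (-1 : ℝ) ^ (l.length / 2) * π ^ l.length / (Nat.factorial l.length) else 0

/-- The sum of a functional over the stuffle product of two words. -/
def stuffleSum {A : Type*} [AddCommMonoid A] (Φ : List ℕ → A) (u v : List ℕ) : A :=
  ((stuffle u v).map Φ).sum

/-- All letters of the word are positive. -/
def PosWord (w : List ℕ) : Prop := ∀ i ∈ w, 0 < i

/-- A character of the stuffle algebra with values in a commutative ring. -/
structure IsStuffleChar {A : Type*} [CommRing A] (χ : List ℕ → A) : Prop where
  nil : χ [] = 1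
  mul : ∀ u v, PosWord u → PosWord v → χ u * χ v = stuffleSum χ u v

section StuffleSum

variable {A : Type*} [AddCommMonoid A]

@[simp] lemma stuffleSum_nil_left (Φ : List ℕ → A) (v : List ℕ) : stuffleSum Φ [] v = Φ v := by
  simp [stuffleSum, stuffle]

@[simp] lemma stuffleSum_nil_right (Φ : List ℕ → A) (u : List ℕ) : stuffleSum Φ u [] = Φ u := by
  cases u <;> simp [stuffleSum, stuffle]

lemma stuffleSum_cons_cons (Φ : List ℕ → A) (a b : ℕ) (u v : List ℕ) :
    stuffleSum Φ (a :: u) (b :: v) = stuffleSum (fun w => Φ (a :: w)) u (b :: v) +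
      stuffleSum (fun w => Φ (b :: w)) (a :: u) v +
        stuffleSum (fun w => Φ ((a + b) :: w)) u v := by
  simp [stuffleSum, stuffle, Multiset.map_map]

lemma stuffleSum_add (Φ Ψ : List ℕ → A) (u v : List ℕ) :
    stuffleSum (fun w => Φ w + Ψ w) u v = stuffleSum Φ u v + stuffleSum Ψ u v := by
  simp [stuffleSum]

lemma stuffleSum_zero (u v : List ℕ) : stuffleSum (fun _ => (0 : A)) u v = 0 := by
  simp [stuffleSum]

lemma stuffleSum_mul_left {A : Type*} [CommRing A] (c : A) (Φ : List ℕ → A) (u v : List ℕ) :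
    stuffleSum (fun w => c * Φ w) u v = c * stuffleSum Φ u v := by
  simp [stuffleSum, Multiset.sum_map_mul_left]

end StuffleSum

lemma posWord_cons {a : ℕ} {w : List ℕ} : PosWord (a :: w) ↔ 0 < a ∧ PosWord w := by
  simp [PosWord]

lemma posWord_append {u v : List ℕ} : PosWord (u ++ v) ↔ PosWord u ∧ PosWord v := by
  simp only [PosWord, List.mem_append]
  exact ⟨fun h => ⟨fun i hi => h i (.inl hi), fun i hi => h i (.inr hi)⟩,
    fun h i hi => hi.elim (h.1 i) (h.2 i)⟩

lemma posWord_replicate_one (p : ℕ) : PosWord (List.replicate p 1) := by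
  intro i hi
  simp [List.eq_of_mem_replicate hi]

lemma PosWord.reverse {w : List ℕ} (h : PosWord w) : PosWord w.reverse :=
  fun i hi => h i (List.mem_reverse.1 hi)

lemma PosWord.take {w : List ℕ} (h : PosWord w) (n : ℕ) : PosWord (w.take n) :=
  fun i hi => h i (List.mem_of_mem_take hi)

lemma PosWord.drop {w : List ℕ} (h : PosWord w) (n : ℕ) : PosWord (w.drop n) :=
  fun i hi => h i (List.mem_of_mem_drop hi)

section Induction

/-- Positive words containing a letter `≥ 2` and ending in at most `p` ones. -/
def TrailingOnesLE (p : ℕ) (x : List ℕ) : Prop :=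
  PosWord x ∧ ∃ v k q, q ≤ p ∧ 2 ≤ k ∧ x = v ++ k :: List.replicate q 1

lemma TrailingOnesLE.cons {p a : ℕ} {x : List ℕ} (ha : 0 < a) (h : TrailingOnesLE p x) :
    TrailingOnesLE p (a :: x) := by
  obtain ⟨hx, v, k, q, hq, hk, rfl⟩ := h
  exact ⟨posWord_cons.2 ⟨ha, hx⟩, a :: v, k, q, hq, hk, rfl⟩

lemma stuffle_cons_one (a : ℕ) (u : List ℕ) :
    stuffle (a :: u) [1] = (stuffle u [1]).map (a :: ·) + {1 :: a :: u} + {(a + 1) :: u} := by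
  cases u <;> simp [stuffle]

lemma stuffle_ones_one (p : ℕ) :
    ∃ rest : Multiset (List ℕ), (∀ x ∈ rest, TrailingOnesLE p x) ∧
      stuffle (List.replicate p 1) [1] = (p + 1) • {List.replicate (p + 1) 1} + rest := by
  induction p with
  | zero => exact ⟨0, by simp, by simp [stuffle]⟩
  | succ p ih =>
    obtain ⟨rest, hrest, h⟩ := ih
    refine ⟨rest.map (1 :: ·) + {2 :: List.replicate p 1}, ?_, ?_⟩
    · intro x hx
      rcases Multiset.mem_add.1 hx with hx | hx
      · obtain ⟨y, hy, rfl⟩ := Multiset.mem_map.1 hx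
        obtain ⟨h1, v, k, q, hq, hk, rfl⟩ := hrest y hy
        exact TrailingOnesLE.cons one_pos ⟨h1, v, k, q, by omega, hk, rfl⟩
      · rw [Multiset.mem_singleton.1 hx]
        exact ⟨posWord_cons.2 ⟨by norm_num, posWord_replicate_one p⟩, [], 2, p, by omega, le_rfl,
          rfl⟩
    · rw [List.replicate_succ, stuffle_cons_one, h]
      simp only [Multiset.map_add, Multiset.map_nsmul, Multiset.map_singleton,
        ← List.replicate_succ]
      rw [succ_nsmul _ (p + 1)]
      abel

lemma stuffle_trailing_one (v : List ℕ) (k p : ℕ) (hk : 2 ≤ k) (hv : PosWord v) :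
    ∃ rest : Multiset (List ℕ), (∀ x ∈ rest, TrailingOnesLE p x) ∧
      stuffle (v ++ k :: List.replicate p 1) [1] =
        (p + 1) • {v ++ k :: List.replicate (p + 1) 1} + rest := by
  have hpos : PosWord (k :: List.replicate p 1) :=
    posWord_cons.2 ⟨by omega, posWord_replicate_one p⟩
  induction v with
  | nil =>
    obtain ⟨rest, hrest, h⟩ := stuffle_ones_one p
    refine ⟨rest.map (k :: ·) + {1 :: k :: List.replicate p 1} + {(k + 1) :: List.replicate p 1},
      ?_, ?_⟩
    · intro x hx
      simp only [Multiset.mem_add, Multiset.mem_map, Multiset.mem_singleton] at hx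
      rcases hx with (⟨y, hy, rfl⟩ | rfl) | rfl
      · exact (hrest y hy).cons (by omega)
      · exact TrailingOnesLE.cons one_pos ⟨hpos, [], k, p, le_rfl, hk, rfl⟩
      · exact ⟨posWord_cons.2 ⟨by omega, posWord_replicate_one p⟩, [], k + 1, p, le_rfl,
          by omega, rfl⟩
    · rw [List.nil_append, stuffle_cons_one, h]
      simp only [Multiset.map_add, Multiset.map_nsmul, Multiset.map_singleton, List.nil_append]
      abel
  | cons a v ih =>
    obtain ⟨ha, hv⟩ := posWord_cons.1 hv
    obtain ⟨rest, hrest, h⟩ := ih hv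
    have hw : TrailingOnesLE p (v ++ k :: List.replicate p 1) :=
      ⟨posWord_append.2 ⟨hv, hpos⟩, v, k, p, le_rfl, hk, rfl⟩
    refine ⟨rest.map (a :: ·) + {1 :: a :: (v ++ k :: List.replicate p 1)} +
      {(a + 1) :: (v ++ k :: List.replicate p 1)}, ?_, ?_⟩
    · intro x hx
      simp only [Multiset.mem_add, Multiset.mem_map, Multiset.mem_singleton] at hx
      rcases hx with (⟨y, hy, rfl⟩ | rfl) | rfl
      · exact (hrest y hy).cons ha
      · exact (hw.cons ha).cons one_pos
      · exact hw.cons (by omega)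
    · rw [List.cons_append, stuffle_cons_one, h]
      simp only [Multiset.map_add, Multiset.map_nsmul, Multiset.map_singleton, List.cons_append]
      abel

lemma exists_trailing_ones {w : List ℕ} (hw : PosWord w) :
    ∃ p, w = List.replicate p 1 ∨ ∃ v k, 2 ≤ k ∧ w = v ++ k :: List.replicate p 1 := by
  induction w with
  | nil => exact ⟨0, .inl rfl⟩
  | cons a w ih =>
    obtain ⟨ha, hw⟩ := posWord_cons.1 hw
    obtain ⟨p, rfl | ⟨v, k, hk, rfl⟩⟩ := ih hw
    · rcases Nat.lt_or_ge 1 a with h | h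
      · exact ⟨p, .inr ⟨[], a, h, rfl⟩⟩
      · exact ⟨p + 1, .inl (by rw [show a = 1 by omega, List.replicate_succ])⟩
    · exact ⟨p, .inr ⟨a :: v, k, hk, rfl⟩⟩

/-- Induction over positive words: every word is obtained from the empty word, and words whose
last letter is at least `2`, by stuffle multiplication with the word `(1)`. -/
theorem stuffle_induction {P : List ℕ → Prop} (nil : P [])
    (adm : ∀ v k, PosWord v → 2 ≤ k → P (v ++ [k]))
    (step : ∀ (u w : List ℕ) (n : ℕ) (rest : Multiset (List ℕ)), PosWord u →
      stuffle u [1] = (n + 1) • {w} + rest → P u → (∀ x ∈ rest, P x) → P w)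
    (w : List ℕ) (hw : PosWord w) : P w := by
  have key : ∀ p, P (List.replicate p 1) ∧
      ∀ v k, PosWord v → 2 ≤ k → P (v ++ k :: List.replicate p 1) := by
    intro p
    induction p using Nat.strong_induction_on with
    | _ p ih =>
      rcases p with _ | p
      · exact ⟨nil, adm⟩
      have hgood : ∀ x, TrailingOnesLE p x → P x := by
        rintro x ⟨hx, v, k, q, hq, hk, rfl⟩
        exact (ih q (by omega)).2 v k (posWord_append.1 hx).1 hk
      constructor
      · obtain ⟨rest, hrest, h⟩ := stuffle_ones_one p
        exact step _ _ p rest (posWord_replicate_one p) h (ih p (by omega)).1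
          fun x hx => hgood x (hrest x hx)
      · intro v k hv hk
        obtain ⟨rest, hrest, h⟩ := stuffle_trailing_one v k p hk hv
        refine step _ _ p rest ?_ h ((ih p (by omega)).2 v k hv hk)
          fun x hx => hgood x (hrest x hx)
        exact posWord_append.2 ⟨hv, posWord_cons.2 ⟨by omega, posWord_replicate_one p⟩⟩
  obtain ⟨p, rfl | ⟨v, k, hk, rfl⟩⟩ := exists_trailing_ones hw
  · exact (key p).1
  · exact (key p).2 v k (posWord_append.1 hw).1 hk

lemma IsStuffleChar.eq_of_stuffle {A : Type*} [Field A] [CharZero A] {χ : List ℕ → A}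
    (hχ : IsStuffleChar χ) {u w : List ℕ} {n : ℕ} {rest : Multiset (List ℕ)} (hu : PosWord u)
    (h : stuffle u [1] = (n + 1) • {w} + rest) :
    χ w = ((n : A) + 1)⁻¹ * (χ u * χ [1] - (rest.map χ).sum) := by
  rw [hχ.mul u [1] hu (by simp [PosWord]), stuffleSum, h]
  have : (n : A) + 1 ≠ 0 := by exact_mod_cast n.succ_ne_zero
  simp only [Multiset.map_add, Multiset.map_nsmul, Multiset.map_singleton, Multiset.sum_add,
    Multiset.sum_nsmul, Multiset.sum_singleton, nsmul_eq_mul]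
  field_simp
  push_cast
  ring

/-- Two characters that agree on `(1)` and on words ending in a letter `≥ 2` are equal. -/
theorem IsStuffleChar.ext_of_admissible {A : Type*} [Field A] [CharZero A] {χ ψ : List ℕ → A}
    (hχ : IsStuffleChar χ) (hψ : IsStuffleChar ψ) (one : χ [1] = ψ [1])
    (adm : ∀ v k, PosWord v → 2 ≤ k → χ (v ++ [k]) = ψ (v ++ [k]))
    (w : List ℕ) (hw : PosWord w) : χ w = ψ w := by
  refine stuffle_induction (P := fun w => χ w = ψ w) (by rw [hχ.nil, hψ.nil]) adm ?_ w hw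
  intro u w n rest hu h hPu hrest
  rw [hχ.eq_of_stuffle hu h, hψ.eq_of_stuffle hu h, hPu, one, Multiset.map_congr rfl hrest]

end Induction

section FiniteCharacters

/-- The functional with value `g n` on `(1,…,1)` of length `n`, and `0` on all other words. -/
def onesFun (g : ℕ → ℂ) (w : List ℕ) : ℂ := if ∀ i ∈ w, i = 1 then g w.length else 0

lemma onesFun_cons (g : ℕ → ℂ) (a : ℕ) (w : List ℕ) :
    onesFun g (a :: w) = onesFun (fun n => if a = 1 then g (n + 1) else 0) w := by
  by_cases ha : a = 1 <;> simp [onesFun, ha]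

lemma onesFun_zero (w : List ℕ) : onesFun (fun _ => 0) w = 0 := by simp [onesFun]

lemma stuffleSum_onesFun (u v : List ℕ) (hu : PosWord u) (hv : PosWord v) (g : ℕ → ℂ) :
    stuffleSum (onesFun g) u v = if (∀ i ∈ u, i = 1) ∧ ∀ i ∈ v, i = 1 then
      ((u.length + v.length).choose u.length : ℂ) * g (u.length + v.length) else 0 := by
  induction u generalizing v g with
  | nil => simp [onesFun]
  | cons a u ihu =>
    induction v generalizing g with
    | nil => simp [onesFun]
    | cons b v ihv =>
      obtain ⟨ha, hu'⟩ := posWord_cons.1 hu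
      obtain ⟨hb, hv'⟩ := posWord_cons.1 hv
      have hab : a + b ≠ 1 := by omega
      simp only [stuffleSum_cons_cons, onesFun_cons, hab, if_false, onesFun_zero, stuffleSum_zero]
      rw [ihu (b :: v) hu' hv, ihv hv']
      by_cases h : (∀ i ∈ u, i = 1) ∧ ∀ i ∈ v, i = 1
      · obtain ⟨h1, h2⟩ := h
        by_cases ha1 : a = 1
        · by_cases hb1 : b = 1
          · have h1' : ∀ i ∈ a :: u, i = 1 := List.forall_mem_cons.2 ⟨ha1, h1⟩
            have h2' : ∀ i ∈ b :: v, i = 1 := List.forall_mem_cons.2 ⟨hb1, h2⟩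
            rw [if_pos ⟨h1, h2'⟩, if_pos ha1, if_pos ⟨h1', h2⟩, if_pos hb1, if_pos ⟨h1', h2'⟩]
            have e : u.length + 1 + (v.length + 1) = (u.length + v.length + 1) + 1 := by ring
            have e1 : u.length + (v.length + 1) = u.length + v.length + 1 := by ring
            have e2 : u.length + 1 + v.length = u.length + v.length + 1 := by ring
            rw [List.length_cons, List.length_cons, e, e1, e2,
              Nat.choose_succ_succ (u.length + v.length + 1) u.length]
            push_cast
            ring
          · have h2' : ¬∀ i ∈ b :: v, i = 1 := fun h => hb1 (h b (by simp))
            rw [if_neg fun h => h2' h.2, if_neg (c := _ ∧ ∀ i ∈ b :: v, i = 1) fun h => h2' h.2]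
            simp [hb1]
        · have h1' : ¬∀ i ∈ a :: u, i = 1 := fun h => ha1 (h a (by simp))
          rw [if_neg (c := (∀ i ∈ a :: u, i = 1) ∧ ∀ i ∈ v, i = 1) fun h => h1' h.1,
            if_neg (c := (∀ i ∈ a :: u, i = 1) ∧ _) fun h => h1' h.1]
          simp [ha1]
      · rw [if_neg fun h' => h ⟨h'.1, fun i hi => h'.2 i (by simp [hi])⟩,
          if_neg fun h' => h ⟨fun i hi => h'.1 i (by simp [hi]), h'.2⟩,
          if_neg fun h' => h ⟨fun i hi => h'.1 i (by simp [hi]), fun i hi => h'.2 i (by simp [hi])⟩]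
        simp

/-- The character with value `c ^ n / n!` on `(1,…,1)` of length `n`. -/
noncomputable def expOnes (c : ℂ) : List ℕ → ℂ := onesFun fun n => c ^ n / n.factorial

lemma expOnes_nil (c : ℂ) : expOnes c [] = 1 := by simp [expOnes, onesFun]

lemma expOnes_one (c : ℂ) : expOnes c [1] = c := by simp [expOnes, onesFun]

lemma expOnes_append_singleton (c : ℂ) (w : List ℕ) {k : ℕ} (hk : 2 ≤ k) :
    expOnes c (w ++ [k]) = 0 := by
  rw [expOnes, onesFun, if_neg]
  intro h
  have := h k (by simp)
  omega

lemma isStuffleChar_expOnes (c : ℂ) : IsStuffleChar (expOnes c) where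
  nil := expOnes_nil c
  mul u v hu hv := by
    rw [expOnes, stuffleSum_onesFun u v hu hv]
    by_cases h1 : ∀ i ∈ u, i = 1
    · by_cases h2 : ∀ i ∈ v, i = 1
      · simp only [onesFun]
        rw [if_pos h1, if_pos h2, if_pos ⟨h1, h2⟩, Nat.choose_symm_add,
          ← Nat.add_choose_mul_factorial_mul_factorial u.length v.length]
        have h1 := Nat.factorial_ne_zero u.length
        have h2 := Nat.factorial_ne_zero v.length
        have h3 : (u.length + v.length).choose v.length ≠ 0 :=
          (Nat.choose_pos (Nat.le_add_left _ _)).ne'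
        push_cast
        field_simp
        ring
      · simp only [onesFun]
        rw [if_neg h2, if_neg (c := _ ∧ _) fun h => h2 h.2, mul_zero]
    · simp only [onesFun]
      rw [if_neg h1, if_neg (c := _ ∧ _) fun h => h1 h.1, zero_mul]

lemma sum_expOnes_take_drop (a b : ℂ) (w : List ℕ) :
    ∑ i ∈ Finset.range (w.length + 1), expOnes a (w.take i) * expOnes b (w.drop i) =
      expOnes (a + b) w := by
  by_cases h : ∀ i ∈ w, i = 1
  · have ht : ∀ n, ∀ i ∈ w.take n, i = 1 := fun n i hi => h i (List.mem_of_mem_take hi)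
    have hd : ∀ n, ∀ i ∈ w.drop n, i = 1 := fun n i hi => h i (List.mem_of_mem_drop hi)
    simp only [expOnes, onesFun, if_pos h, if_pos (ht _), if_pos (hd _)]
    rw [add_pow, Finset.sum_div]
    refine Finset.sum_congr rfl fun i hi => ?_
    have hi' : i ≤ w.length := Nat.lt_succ_iff.1 (Finset.mem_range.1 hi)
    rw [List.length_take, List.length_drop, min_eq_left hi', Nat.cast_choose ℂ hi']
    have h1 := Nat.factorial_ne_zero i
    have h2 := Nat.factorial_ne_zero (w.length - i)
    have h3 := Nat.factorial_ne_zero w.length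
    field_simp
  · simp only [expOnes, onesFun, if_neg h]
    refine Finset.sum_eq_zero fun i _ => ?_
    by_cases h1 : ∀ j ∈ w.take i, j = 1
    · by_cases h2 : ∀ j ∈ w.drop i, j = 1
      · refine absurd (fun j hj => ?_) h
        rw [← List.take_append_drop i w, List.mem_append] at hj
        exact hj.elim (h1 j) (h2 j)
      · rw [if_neg h2, mul_zero]
    · rw [if_neg h1, zero_mul]

/-- The truncated multiple zeta sum attached to a finite list of points, followed by the
character `expOnes c`. -/
noncomputable def truncSum (c : ℂ) : List ℂ → List ℕ → ℂ
  | [], w => expOnes c w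
  | _ :: _, [] => 1
  | x :: xs, k :: w => x ^ k * truncSum c xs w + truncSum c xs (k :: w)

@[simp] lemma truncSum_nil (c : ℂ) (xs : List ℂ) : truncSum c xs [] = 1 := by
  cases xs <;> simp [truncSum, expOnes_nil]

lemma isStuffleChar_truncSum (c : ℂ) (xs : List ℂ) : IsStuffleChar (truncSum c xs) := by
  refine ⟨truncSum_nil c xs, ?_⟩
  induction xs with
  | nil => exact (isStuffleChar_expOnes c).mul
  | cons x xs ih =>
    rintro (_ | ⟨a, u⟩) (_ | ⟨b, v⟩) hu hv
    · simp
    · simp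
    · simp
    · simp only [truncSum, stuffleSum_cons_cons, stuffleSum_add, stuffleSum_mul_left]
      have hu' := (posWord_cons.1 hu).2
      have hv' := (posWord_cons.1 hv).2
      rw [← ih u (b :: v) hu' hv, ← ih (a :: u) v hu hv', ← ih u v hu' hv']
      have h := ih (a :: u) (b :: v) hu hv
      rw [stuffleSum_cons_cons] at h
      linear_combination h

lemma truncSum_append_singleton (c : ℂ) (xs : List ℂ) (w : List ℕ) {k : ℕ} (hk : 2 ≤ k) :
    truncSum c xs (w ++ [k]) = truncSum 0 xs (w ++ [k]) := by
  induction xs generalizing w with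
  | nil => simp only [truncSum, expOnes_append_singleton _ _ hk]
  | cons x xs ih =>
    rcases w with _ | ⟨a, w⟩
    · have := ih []
      simp only [List.nil_append] at this ⊢
      simp [truncSum, this]
    · have h2 := ih (a :: w)
      simp only [List.cons_append] at h2 ⊢
      simp only [truncSum, ih w, h2]

/-- The derivation on words: `∑ kᵢ Φ(k₁,…,kᵢ+1,…,k_d)`. -/
def derivSum (Φ : List ℕ → ℂ) : List ℕ → ℂ
  | [] => 0
  | k :: w => k * Φ ((k + 1) :: w) + derivSum (fun v => Φ (k :: v)) w

lemma derivSum_add (Φ Ψ : List ℕ → ℂ) (w : List ℕ) :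
    derivSum (fun v => Φ v + Ψ v) w = derivSum Φ w + derivSum Ψ w := by
  induction w generalizing Φ Ψ with
  | nil => simp [derivSum]
  | cons k w ih => simp only [derivSum, ih]; ring

lemma derivSum_const_mul (c : ℂ) (Φ : List ℕ → ℂ) (w : List ℕ) :
    derivSum (fun v => c * Φ v) w = c * derivSum Φ w := by
  induction w generalizing Φ with
  | nil => simp [derivSum]
  | cons k w ih => simp only [derivSum, ih]; ring

lemma derivSum_onesFun (g : ℕ → ℂ) (w : List ℕ) : derivSum (onesFun g) w = 0 := by
  induction w generalizing g with
  | nil => simp [derivSum]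
  | cons k w ih =>
    simp only [derivSum, onesFun_cons, ih]
    rcases Nat.eq_zero_or_pos k with rfl | hk
    · simp
    · simp [hk.ne', onesFun_zero]

/-- The points `1/(z+1), …, 1/(z+N)`. -/
noncomputable def shiftPts (N : ℕ) (z : ℂ) : List ℂ :=
  (List.range N).map fun i : ℕ => (z + (i + 1))⁻¹

lemma hasDerivAt_truncSum_map (c : ℂ) (l : List ℕ) (z : ℂ) (hz : ∀ i ∈ l, z + (i + 1) ≠ 0)
    (w : List ℕ) :
    HasDerivAt (fun z => truncSum c (l.map fun i : ℕ => (z + (i + 1))⁻¹) w)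
      (-derivSum (truncSum c (l.map fun i : ℕ => (z + (i + 1))⁻¹)) w) z := by
  induction l generalizing w with
  | nil => simpa [truncSum, expOnes, derivSum_onesFun] using hasDerivAt_const z _
  | cons i l ih =>
    rcases w with _ | ⟨k, w⟩
    · simpa [derivSum] using hasDerivAt_const z (1 : ℂ)
    · have hz' : ∀ j ∈ l, z + ((j : ℂ) + 1) ≠ 0 := fun j hj => hz j (List.mem_cons_of_mem _ hj)
      have hi : z + ((i : ℂ) + 1) ≠ 0 := hz i (by simp)
      have hx : HasDerivAt (fun z : ℂ => (z + ((i : ℂ) + 1))⁻¹ ^ k)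
          (-(k * (z + ((i : ℂ) + 1))⁻¹ ^ (k + 1))) z := by
        have h := (((hasDerivAt_id z).add_const ((i : ℂ) + 1)).inv hi).pow k
        refine h.congr_deriv ?_
        rcases k with _ | k
        · simp
        · simp only [Nat.add_sub_cancel, Pi.inv_apply, id_eq, inv_pow]
          field_simp
          ring
      simp only [List.map_cons, truncSum]
      have h := (hx.mul (ih hz' w)).add (ih hz' (k :: w))
      refine h.congr_deriv ?_
      simp only [derivSum, truncSum, derivSum_add, derivSum_const_mul]
      ring

end FiniteCharacters

section Convergence

open Filter Topology Asymptotics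

/-- The harmonic number `1 + 1/2 + ⋯ + 1/n`. -/
noncomputable def harmonicSum (n : ℕ) : ℝ := ∑ i ∈ Finset.range n, ((i : ℝ) + 1)⁻¹

lemma harmonicSum_nonneg (n : ℕ) : 0 ≤ harmonicSum n :=
  Finset.sum_nonneg fun i _ => by positivity

lemma harmonicSum_mono : Monotone harmonicSum := by
  refine monotone_nat_of_le_succ fun n => ?_
  rw [harmonicSum, harmonicSum, Finset.sum_range_succ]
  exact le_add_of_nonneg_right (by positivity)

lemma harmonicSum_le (n : ℕ) : harmonicSum n ≤ 1 + Real.log (n + 1) := by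
  have h := harmonic_le_one_add_log n
  have e : ((harmonic n : ℚ) : ℝ) = harmonicSum n := by
    simp [harmonic, harmonicSum]
  rw [e] at h
  refine h.trans (add_le_add_right ?_ _)
  rcases Nat.eq_zero_or_pos n with rfl | hn
  · simp
  · exact Real.log_le_log (by positivity) (by linarith)

lemma summable_harmonicSum_pow (d : ℕ) :
    Summable fun n : ℕ => harmonicSum n ^ d * (((n : ℝ) + 1) ^ (3 / 2 : ℝ))⁻¹ := by
  set ε : ℝ := 1 / (4 * (d + 1)) with hε
  have hε0 : 0 < ε := by positivity
  have hs : Summable fun n : ℕ => (1 + 1 / ε) ^ d * (((n : ℝ) + 1) ^ (5 / 4 : ℝ))⁻¹ := by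
    refine Summable.mul_left _ ?_
    have h := (summable_nat_add_iff 1).2
      (Real.summable_nat_rpow_inv.2 (show (1 : ℝ) < 5 / 4 by norm_num))
    simpa using h
  refine hs.of_nonneg_of_le (fun n => mul_nonneg (pow_nonneg (harmonicSum_nonneg n) d)
    (by positivity)) fun n => ?_
  have hn : (1 : ℝ) ≤ n + 1 := by linarith [(Nat.cast_nonneg n : (0 : ℝ) ≤ n)]
  have hn0 : (0 : ℝ) < n + 1 := by linarith
  have h1 : harmonicSum n ≤ (1 + 1 / ε) * ((n : ℝ) + 1) ^ ε := by
    have h2 := Real.log_le_rpow_div hn0.le hε0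
    have h3 := Real.one_le_rpow hn hε0.le
    calc harmonicSum n ≤ 1 + Real.log (n + 1) := harmonicSum_le n
      _ ≤ ((n : ℝ) + 1) ^ ε + ((n : ℝ) + 1) ^ ε / ε := add_le_add h3 h2
      _ = _ := by ring
  have h4 : harmonicSum n ^ d ≤ (1 + 1 / ε) ^ d * ((n : ℝ) + 1) ^ (1 / 4 : ℝ) := by
    refine (pow_le_pow_left₀ (harmonicSum_nonneg n) h1 d).trans ?_
    rw [mul_pow, ← Real.rpow_mul_natCast hn0.le]
    refine mul_le_mul_of_nonneg_left (Real.rpow_le_rpow_of_exponent_le hn ?_) (by positivity)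
    rw [hε]
    field_simp
    linarith
  calc _ ≤ (1 + 1 / ε) ^ d * ((n : ℝ) + 1) ^ (1 / 4 : ℝ) * (((n : ℝ) + 1) ^ (3 / 2 : ℝ))⁻¹ :=
        mul_le_mul_of_nonneg_right h4 (by positivity)
    _ = _ := by
      rw [mul_assoc, ← Real.rpow_neg hn0.le, ← Real.rpow_neg hn0.le, ← Real.rpow_add hn0]
      norm_num

lemma truncSum_zero_concat (xs : List ℂ) (x : ℂ) (w : List ℕ) (k : ℕ) :
    truncSum 0 (xs ++ [x]) (w ++ [k]) =
      truncSum 0 xs (w ++ [k]) + truncSum 0 xs w * x ^ k := by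
  have h0 : ∀ v : List ℕ, v ≠ [] → expOnes 0 v = 0 := by
    rintro (_ | ⟨a, v⟩) hv
    · exact absurd rfl hv
    · simp [expOnes, onesFun]
  induction xs generalizing w with
  | nil =>
    rcases w with _ | ⟨a, w⟩
    · simp [truncSum, expOnes_nil, h0]
    · simp [truncSum, h0]
  | cons y xs ih =>
    rcases w with _ | ⟨a, w⟩
    · have := ih []
      simp only [List.nil_append, truncSum_nil, one_mul] at this
      simp [truncSum, this, add_assoc]
    · have h1 := ih (a :: w)
      have h2 := ih w
      simp only [List.cons_append] at h1 ⊢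
      simp only [truncSum, h1, h2]
      ring

lemma shiftPts_succ (N : ℕ) (z : ℂ) :
    shiftPts (N + 1) z = shiftPts N z ++ [(z + (N + 1))⁻¹] := by
  simp [shiftPts, List.range_succ]

lemma truncSum_zero_shiftPts (N : ℕ) (z : ℂ) (w : List ℕ) (k : ℕ) :
    truncSum 0 (shiftPts N z) (w ++ [k]) =
      ∑ n ∈ Finset.range N, truncSum 0 (shiftPts n z) w * (z + (n + 1))⁻¹ ^ k := by
  induction N with
  | zero => simp [shiftPts, truncSum, expOnes, onesFun]
  | succ N ih => rw [shiftPts_succ, truncSum_zero_concat, ih, Finset.sum_range_succ]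

lemma norm_truncSum_le {A : ℝ} (hA : 1 ≤ A) {z : ℂ}
    (hz : ∀ n : ℕ, ‖(z + (n + 1))⁻¹‖ ≤ A / (n + 1)) (w : List ℕ) (hw : PosWord w) (N : ℕ) :
    ‖truncSum 0 (shiftPts N z) w‖ ≤ A ^ w.sum * harmonicSum N ^ w.length := by
  induction w using List.reverseRecOn generalizing N with
  | nil => simp
  | append_singleton w k ih =>
    obtain ⟨hw, hk⟩ := posWord_append.1 hw
    have hk : 0 < k := hk k (by simp)
    rw [truncSum_zero_shiftPts]
    refine (norm_sum_le _ _).trans ?_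
    have hb : ∀ n ∈ Finset.range N, ‖truncSum 0 (shiftPts n z) w * (z + (n + 1))⁻¹ ^ k‖ ≤
        A ^ w.sum * harmonicSum N ^ w.length * A ^ k * ((n : ℝ) + 1)⁻¹ := by
      intro n hn
      rw [norm_mul, norm_pow]
      have h1 : ‖(z + (n + 1))⁻¹‖ ^ k ≤ A ^ k * ((n : ℝ) + 1)⁻¹ := by
        refine (pow_le_pow_left₀ (norm_nonneg _) (hz n) k).trans ?_
        rw [div_eq_mul_inv, mul_pow]
        refine mul_le_mul_of_nonneg_left ?_ (by positivity)
        refine pow_le_of_le_one (by positivity) (inv_le_one_of_one_le₀ ?_) hk.ne'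
        linarith [(Nat.cast_nonneg n : (0 : ℝ) ≤ n)]
      have h2 : ‖truncSum 0 (shiftPts n z) w‖ ≤ A ^ w.sum * harmonicSum N ^ w.length := by
        refine (ih hw n).trans (mul_le_mul_of_nonneg_left ?_ (by positivity))
        exact pow_le_pow_left₀ (harmonicSum_nonneg n)
          (harmonicSum_mono (Finset.mem_range.1 hn).le) _
      calc _ ≤ A ^ w.sum * harmonicSum N ^ w.length * (A ^ k * ((n : ℝ) + 1)⁻¹) :=
            mul_le_mul h2 h1 (by positivity)
              (mul_nonneg (by positivity) (pow_nonneg (harmonicSum_nonneg N) _))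
        _ = _ := by ring
    refine (Finset.sum_le_sum hb).trans (le_of_eq ?_)
    rw [← Finset.mul_sum, ← harmonicSum]
    simp only [List.sum_append, List.sum_singleton, List.length_append, List.length_singleton,
      pow_add, pow_one]
    ring

lemma norm_truncSum_term_le {A B : ℝ} (hA : 1 ≤ A) {z : ℂ}
    (hz : ∀ n : ℕ, ‖(z + (n + 1))⁻¹‖ ≤ A / (n + 1)) (hB : ∀ n : ℕ, √‖(z + (n + 1))⁻¹‖ ≤ B)
    (w : List ℕ) (hw : PosWord w) {k : ℕ} (hk : 2 ≤ k) (n : ℕ) :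
    ‖truncSum 0 (shiftPts n z) w * (z + (n + 1))⁻¹ ^ k‖ ≤ B * A ^ (w.sum + k) *
      (harmonicSum n ^ w.length * (((n : ℝ) + 1) ^ (3 / 2 : ℝ))⁻¹) := by
  have hB0 : 0 ≤ B := (Real.sqrt_nonneg _).trans (hB 0)
  have hn0 : (0 : ℝ) < n + 1 := by positivity
  set x := ‖(z + (n + 1))⁻¹‖ with hx
  have hx0 : 0 ≤ x := norm_nonneg _
  have hk' : x ^ k ≤ B * (A ^ k * (((n : ℝ) + 1) ^ (3 / 2 : ℝ))⁻¹) := by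
    have e1 : x ^ k = √x * (x ^ (3 / 2 : ℝ) * x ^ (k - 2)) := by
      obtain ⟨j, rfl⟩ := Nat.exists_eq_add_of_le hk
      rw [Real.sqrt_eq_rpow, ← mul_assoc, ← Real.rpow_add_of_nonneg hx0 (by norm_num)
        (by norm_num), pow_add, Nat.add_sub_cancel_left, ← Real.rpow_natCast x 2]
      norm_num
    have h3 : x ^ (3 / 2 : ℝ) ≤ A ^ 2 * (((n : ℝ) + 1) ^ (3 / 2 : ℝ))⁻¹ := by
      refine (Real.rpow_le_rpow hx0 (hz n) (by norm_num)).trans ?_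
      rw [Real.div_rpow (by positivity) hn0.le, div_eq_mul_inv]
      refine mul_le_mul_of_nonneg_right ?_ (by positivity)
      rw [← Real.rpow_natCast]
      exact Real.rpow_le_rpow_of_exponent_le hA (by norm_num)
    have h4 : x ^ (k - 2) ≤ A ^ (k - 2) := by
      refine pow_le_pow_left₀ hx0 ((hz n).trans (div_le_self (by positivity) ?_)) _
      linarith [(Nat.cast_nonneg n : (0 : ℝ) ≤ n)]
    rw [e1]
    refine mul_le_mul (hB n) ?_ (by positivity) hB0
    calc _ ≤ A ^ 2 * (((n : ℝ) + 1) ^ (3 / 2 : ℝ))⁻¹ * A ^ (k - 2) :=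
          mul_le_mul h3 h4 (by positivity) (by positivity)
      _ = A ^ (2 + (k - 2)) * (((n : ℝ) + 1) ^ (3 / 2 : ℝ))⁻¹ := by rw [pow_add]; ring
      _ = _ := by rw [Nat.add_sub_cancel' hk]
  rw [norm_mul, norm_pow]
  calc _ ≤ A ^ w.sum * harmonicSum n ^ w.length *
        (B * (A ^ k * (((n : ℝ) + 1) ^ (3 / 2 : ℝ))⁻¹)) :=
        mul_le_mul (norm_truncSum_le hA hz w hw n) hk' (by positivity)
          (mul_nonneg (by positivity) (pow_nonneg (harmonicSum_nonneg n) _))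
    _ = _ := by rw [pow_add]; ring

/-- The complement of the set of negative integers. -/
def polesCompl : Set ℂ := {z | ∀ n : ℕ, z + (n + 1) ≠ 0}

lemma exists_bound_nhds {z₀ : ℂ} (hz₀ : z₀ ∈ polesCompl) :
    ∃ A : ℝ, 1 ≤ A ∧ ∀ᶠ z in 𝓝 z₀, z ∈ polesCompl ∧
      ∀ n : ℕ, ‖(z + (n + 1))⁻¹‖ ≤ A / (n + 1) := by
  obtain ⟨M, hM⟩ := exists_nat_ge (2 * (‖z₀‖ + 1))
  set b : ℕ → ℝ := fun n => ‖(z₀ + (n + 1))⁻¹‖ + 1 with hb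
  have hb0 : ∀ n, 0 ≤ b n := fun n => by positivity
  refine ⟨2 + ∑ n ∈ Finset.range M, b n * (n + 1), ?_, ?_⟩
  · have : 0 ≤ ∑ n ∈ Finset.range M, b n * (n + 1) :=
      Finset.sum_nonneg fun n _ => mul_nonneg (hb0 n) (by positivity)
    linarith
  · have h1 : ∀ᶠ z in 𝓝 z₀, ∀ n ∈ Finset.range M,
        z + ((n : ℂ) + 1) ≠ 0 ∧ ‖(z + ((n : ℂ) + 1))⁻¹‖ < b n := by
      rw [Filter.eventually_all_finset]
      intro n _
      have hc : ContinuousAt (fun z : ℂ => z + ((n : ℂ) + 1)) z₀ := by fun_prop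
      exact (hc.eventually_ne (hz₀ n)).and
        ((hc.inv₀ (hz₀ n)).norm.eventually_lt continuousAt_const (lt_add_one _))
    filter_upwards [h1, Metric.ball_mem_nhds z₀ one_pos] with z hz hz1
    have hz2 : ‖z‖ ≤ ‖z₀‖ + 1 := by
      have := norm_sub_norm_le z z₀
      have h2 : ‖z - z₀‖ < 1 := by simpa [dist_eq_norm] using hz1
      linarith
    have hfar : ∀ n : ℕ, M ≤ n → ((n : ℝ) + 1) / 2 ≤ ‖z + (n + 1)‖ := by
      intro n hn
      have h3 : ‖((n : ℂ) + 1)‖ = n + 1 := by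
        exact_mod_cast Complex.norm_natCast (n + 1)
      have h4 := norm_sub_le_norm_add ((n : ℂ) + 1) z
      rw [h3, add_comm _ z] at h4
      have h5 : (M : ℝ) ≤ n := by exact_mod_cast hn
      linarith
    have hS : 0 ≤ ∑ n ∈ Finset.range M, b n * (n + 1) :=
      Finset.sum_nonneg fun n _ => mul_nonneg (hb0 n) (by positivity)
    refine ⟨fun n => ?_, fun n => ?_⟩
    · rcases lt_or_ge n M with hn | hn
      · exact (hz n (Finset.mem_range.2 hn)).1
      · rw [← norm_pos_iff]
        exact lt_of_lt_of_le (by positivity) (hfar n hn)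
    · rw [le_div_iff₀ (by positivity)]
      rcases lt_or_ge n M with hn | hn
      · have h6 := Finset.single_le_sum (f := fun n : ℕ => b n * ((n : ℝ) + 1))
          (fun n _ => mul_nonneg (hb0 n) (by positivity)) (Finset.mem_range.2 hn)
        have h7 := mul_le_mul_of_nonneg_right (hz n (Finset.mem_range.2 hn)).2.le
          (show (0 : ℝ) ≤ n + 1 by positivity)
        linarith
      · have h8 := hfar n hn
        have h9 : (0 : ℝ) < (n + 1) / 2 := by positivity
        rw [norm_inv, inv_mul_le_iff₀ (h9.trans_le h8)]
        nlinarith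

lemma isOpen_polesCompl : IsOpen polesCompl := by
  rw [isOpen_iff_eventually]
  intro z hz
  obtain ⟨A, _, h⟩ := exists_bound_nhds hz
  exact h.mono fun z hz => hz.1

lemma sqrt_inv_le {A : ℝ} (hA : 1 ≤ A) {z : ℂ}
    (hz : ∀ n : ℕ, ‖(z + (n + 1))⁻¹‖ ≤ A / (n + 1)) (n : ℕ) : √‖(z + (n + 1))⁻¹‖ ≤ √A := by
  refine Real.sqrt_le_sqrt ((hz n).trans (div_le_self (by linarith) ?_))
  linarith [(Nat.cast_nonneg n : (0 : ℝ) ≤ n)]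

/-- A sequence of counterterms regularizing the harmonic series to `T`. -/
def IsCounterterm (T : ℂ) (c : ℕ → ℂ) : Prop :=
  Tendsto (fun N => c N + harmonicSum N) atTop (𝓝 T)

lemma isCounterterm_sub (T : ℂ) : IsCounterterm T fun N => T - harmonicSum N := by
  simp [IsCounterterm]

lemma truncSum_one (c : ℂ) (N : ℕ) (z : ℂ) :
    truncSum c (shiftPts N z) [1] = c + harmonicSum N +
      ∑ n ∈ Finset.range N, ((z + (n + 1))⁻¹ - ((n : ℂ) + 1)⁻¹) := by
  have h : ∀ xs : List ℂ, truncSum c xs [1] = c + xs.sum := by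
    intro xs
    induction xs with
    | nil => simp [truncSum, expOnes_one]
    | cons x xs ih => simp [truncSum, ih]; ring
  have h' : (shiftPts N z).sum = ∑ n ∈ Finset.range N, (z + ((n : ℂ) + 1))⁻¹ := by
    induction N with
    | zero => simp [shiftPts]
    | succ N ih => rw [shiftPts_succ, List.sum_append, ih, Finset.sum_range_succ]; simp
  rw [h, h', harmonicSum, Finset.sum_sub_distrib]
  push_cast
  ring

lemma norm_inv_sub_inv_le {A : ℝ} {z : ℂ} (hz₁ : z ∈ polesCompl)
    (hz : ∀ n : ℕ, ‖(z + (n + 1))⁻¹‖ ≤ A / (n + 1)) (n : ℕ) :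
    ‖(z + (n + 1))⁻¹ - ((n : ℂ) + 1)⁻¹‖ ≤ ‖z‖ * A * (((n : ℝ) + 1) ^ 2)⁻¹ := by
  have h0 : (n : ℂ) + 1 ≠ 0 := by exact_mod_cast n.succ_ne_zero
  have e : (z + (n + 1))⁻¹ - ((n : ℂ) + 1)⁻¹ = -(z * (z + (n + 1))⁻¹ * ((n : ℂ) + 1)⁻¹) := by
    have := hz₁ n
    field_simp
    ring
  have h3 : ‖(n : ℂ) + 1‖ = n + 1 := by exact_mod_cast Complex.norm_natCast (n + 1)
  rw [e, norm_neg, norm_mul, norm_mul, norm_inv ((n : ℂ) + 1), h3]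
  calc _ ≤ ‖z‖ * (A / (n + 1)) * ((n : ℝ) + 1)⁻¹ := by gcongr; exact hz n
    _ = _ := by field_simp

lemma summable_sq_inv : Summable fun n : ℕ => (((n : ℝ) + 1) ^ 2)⁻¹ := by
  have h := (summable_nat_add_iff 1).2 (Real.summable_nat_pow_inv.2 one_lt_two)
  simpa using h

lemma tendstoLocallyUniformlyOn_of_nhds {f : ℕ → ℂ → ℂ} {g : ℂ → ℂ} {s : Set ℂ}
    (h : ∀ z₀ ∈ s, ∃ t ∈ 𝓝 z₀, TendstoUniformlyOn f g atTop t) :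
    TendstoLocallyUniformlyOn f g atTop s := by
  intro u hu z₀ hz₀
  obtain ⟨t, ht, h⟩ := h z₀ hz₀
  exact ⟨t, mem_nhdsWithin_of_mem_nhds ht, h u hu⟩

lemma continuousOn_truncSum (c : ℂ) (N : ℕ) (w : List ℕ) :
    ContinuousOn (fun z => truncSum c (shiftPts N z) w) polesCompl := fun z hz =>
  (hasDerivAt_truncSum_map c (List.range N) z (fun i _ => hz i) w).continuousAt.continuousWithinAt

lemma tendstoLocallyUniformlyOn_truncSum_admissible (w : List ℕ) (hw : PosWord w) {k : ℕ}
    (hk : 2 ≤ k) (c : ℕ → ℂ) :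
    TendstoLocallyUniformlyOn (fun N z => truncSum (c N) (shiftPts N z) (w ++ [k]))
      (fun z => ∑' n : ℕ, truncSum 0 (shiftPts n z) w * (z + (n + 1))⁻¹ ^ k) atTop polesCompl := by
  refine tendstoLocallyUniformlyOn_of_nhds fun z₀ hz₀ => ?_
  obtain ⟨A, hA, h⟩ := exists_bound_nhds hz₀
  refine ⟨_, h, ?_⟩
  simp only [truncSum_append_singleton _ _ _ hk, truncSum_zero_shiftPts]
  refine tendstoUniformlyOn_tsum_nat ((summable_harmonicSum_pow w.length).mul_left
    (√A * A ^ (w.sum + k))) fun n z hz => ?_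
  exact norm_truncSum_term_le hA hz.2 (sqrt_inv_le hA hz.2) w hw hk n

lemma tendstoLocallyUniformlyOn_truncSum_one {T : ℂ} {c : ℕ → ℂ} (hc : IsCounterterm T c) :
    TendstoLocallyUniformlyOn (fun N z => truncSum (c N) (shiftPts N z) [1])
      (fun z => T + ∑' n : ℕ, ((z + (n + 1))⁻¹ - ((n : ℂ) + 1)⁻¹)) atTop polesCompl := by
  refine tendstoLocallyUniformlyOn_of_nhds fun z₀ hz₀ => ?_
  obtain ⟨A, hA, h⟩ := exists_bound_nhds hz₀
  have hb : ∀ᶠ z in 𝓝 z₀, ‖z‖ < ‖z₀‖ + 1 :=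
    continuous_norm.continuousAt.eventually_lt continuousAt_const (lt_add_one _)
  refine ⟨_, h.and hb, ?_⟩
  simp only [truncSum_one]
  refine TendstoUniformlyOn.add ?_ ?_
  · exact fun u hu => (hc.tendstoUniformlyOn_const _) u hu
  · refine tendstoUniformlyOn_tsum_nat (summable_sq_inv.mul_left ((‖z₀‖ + 1) * A)) fun n z hz => ?_
    refine (norm_inv_sub_inv_le hz.1.1 hz.1.2 n).trans ?_
    have := hz.2.le
    gcongr

lemma TendstoLocallyUniformlyOn.multisetSum {s : Set ℂ} (m : Multiset (List ℕ))
    {f : List ℕ → ℕ → ℂ → ℂ} {g : List ℕ → ℂ → ℂ}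
    (h : ∀ x ∈ m, TendstoLocallyUniformlyOn (f x) (g x) atTop s) :
    TendstoLocallyUniformlyOn (fun N z => (m.map fun x => f x N z).sum)
      (fun z => (m.map fun x => g x z).sum) atTop s := by
  induction m using Multiset.induction_on with
  | empty => simpa using (tendsto_const_nhds.tendstoUniformlyOn_const s).tendstoLocallyUniformlyOn
  | cons a m ih =>
    simp only [Multiset.map_cons, Multiset.sum_cons]
    exact (h a (by simp)).add (ih fun x hx => h x (by simp [hx]))

theorem exists_tendstoLocallyUniformlyOn_truncSum (T : ℂ) (w : List ℕ) (hw : PosWord w) :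
    ∃ L : ℂ → ℂ, ∀ c, IsCounterterm T c →
      TendstoLocallyUniformlyOn (fun N z => truncSum (c N) (shiftPts N z) w) L atTop
        polesCompl := by
  refine stuffle_induction (P := fun w => ∃ L : ℂ → ℂ, ∀ c, IsCounterterm T c →
    TendstoLocallyUniformlyOn (fun N z => truncSum (c N) (shiftPts N z) w) L atTop
      polesCompl) ?_ ?_ ?_ w hw
  · refine ⟨fun _ => 1, fun c _ => ?_⟩
    simpa using (tendsto_const_nhds.tendstoUniformlyOn_const _).tendstoLocallyUniformlyOn
  · exact fun v k hv hk =>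
      ⟨_, fun c _ => tendstoLocallyUniformlyOn_truncSum_admissible v hv hk c⟩
  · intro u w n rest hu h hPu hrest
    obtain ⟨L, hL⟩ := hPu
    choose! R hR using hrest
    refine ⟨fun z => ((n : ℂ) + 1)⁻¹ *
      (L z * (T + ∑' n : ℕ, ((z + (n + 1))⁻¹ - ((n : ℂ) + 1)⁻¹)) -
        (rest.map fun x => R x z).sum), fun c hc => ?_⟩
    have h1 := hL c hc
    have h2 := tendstoLocallyUniformlyOn_truncSum_one hc
    have hcont : ∀ {v : List ℕ} {g : ℂ → ℂ}, TendstoLocallyUniformlyOn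
        (fun N z => truncSum (c N) (shiftPts N z) v) g atTop polesCompl →
        ContinuousOn g polesCompl := fun h =>
      h.continuousOn (Frequently.of_forall fun N => continuousOn_truncSum _ N _)
    have h3 := (h1.mul₀ h2 (hcont h1) (hcont h2)).sub
      (TendstoLocallyUniformlyOn.multisetSum rest fun x hx => hR x hx c hc)
    have h4 : TendstoLocallyUniformlyOn (fun (_ : ℕ) (_ : ℂ) => ((n : ℂ) + 1)⁻¹)
        (fun _ => ((n : ℂ) + 1)⁻¹) atTop polesCompl :=
      (tendsto_const_nhds.tendstoUniformlyOn_const _).tendstoLocallyUniformlyOn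
    have h5 := h4.mul₀ h3 continuousOn_const
      (((hcont h1).mul (hcont h2)).sub (continuousOn_multiset_sum rest fun x hx =>
        hcont (hR x hx c hc)))
    refine h5.congr fun N z _ => ?_
    exact ((isStuffleChar_truncSum (c N) (shiftPts N z)).eq_of_stuffle hu h).symm

end Convergence

section MultipleZetaValue

open Filter Topology

/-- Strictly increasing tuples with entries `M+1, …, M+n`. -/
noncomputable def strictBox (M n d : ℕ) : Finset (Fin d → ℕ+) := by
  classical
  exact (Fintype.piFinset fun _ => Finset.Ico (Nat.succPNat M) (Nat.succPNat (M + n))).filter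
    StrictMono

lemma mem_strictBox {M n d : ℕ} {f : Fin d → ℕ+} :
    f ∈ strictBox M n d ↔ (∀ i, M + 1 ≤ (f i : ℕ) ∧ (f i : ℕ) ≤ M + n) ∧ StrictMono f := by
  simp [strictBox, ← PNat.coe_le_coe, ← PNat.coe_lt_coe]

/-- The summand of a multiple zeta value. -/
noncomputable def mzvTerm (l : List ℕ) (f : Fin l.length → ℕ+) : ℝ :=
  ∏ i, 1 / ((f i : ℕ) : ℝ) ^ l.get i

lemma mzvTerm_nonneg (l : List ℕ) (f : Fin l.length → ℕ+) : 0 ≤ mzvTerm l f :=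
  Finset.prod_nonneg fun i _ => by positivity

lemma sum_strictBox_cons (M n k : ℕ) (w : List ℕ) :
    ∑ f ∈ strictBox M (n + 1) (k :: w).length, mzvTerm (k :: w) f =
      1 / ((M : ℝ) + 1) ^ k * ∑ f ∈ strictBox (M + 1) n w.length, mzvTerm w f +
        ∑ f ∈ strictBox (M + 1) n (k :: w).length, mzvTerm (k :: w) f := by
  classical
  rw [← Finset.sum_filter_add_sum_filter_not _ (fun f : Fin (k :: w).length → ℕ+ =>
    ((f ⟨0, by simp⟩ : ℕ+) : ℕ) = M + 1)]
  congr 1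
  · rw [Finset.mul_sum]
    refine Finset.sum_nbij' (fun f => Fin.tail (n := w.length) f)
      (fun g => Fin.cons (α := fun _ : Fin (w.length + 1) => ℕ+) (Nat.succPNat M) g) ?_ ?_ ?_ ?_ ?_
    · intro f hf
      simp only [Finset.mem_filter, mem_strictBox] at hf ⊢
      obtain ⟨⟨h1, h2⟩, h3⟩ := hf
      refine ⟨fun i => ?_, fun i j hij => h2 (Fin.succ_lt_succ_iff.2 hij)⟩
      have h4 := h1 (Fin.succ i)
      have h5 : f ⟨0, by simp⟩ < f (Fin.succ i) := h2 (Fin.succ_pos i)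
      rw [← PNat.coe_lt_coe] at h5
      simp only [Fin.tail]
      omega
    · intro g hg
      simp only [Finset.mem_filter, mem_strictBox] at hg ⊢
      obtain ⟨h1, h2⟩ := hg
      refine ⟨⟨fun i => ?_, ?_⟩, ?_⟩
      · refine Fin.cases ?_ (fun i => ?_) i
        · simp [Fin.cons_zero]
        · have := h1 i
          simp only [Fin.cons_succ]
          omega
      · intro i j
        refine Fin.cases ?_ (fun i => ?_) i <;> refine Fin.cases ?_ (fun j => ?_) j
        · simp
        · intro _
          rw [← PNat.coe_lt_coe]
          have := h1 j
          simp only [Fin.cons_zero, Fin.cons_succ, Nat.succPNat_coe]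
          omega
        · intro h
          exact absurd h (Fin.not_lt_zero _)
        · intro h
          simpa using h2 (Fin.succ_lt_succ_iff.1 h)
      · rfl
    · intro f hf
      simp only [Finset.mem_filter] at hf
      have h : Nat.succPNat M = f ⟨0, by simp⟩ := PNat.eq (by simpa using hf.2.symm)
      rw [h]
      exact Fin.cons_self_tail (n := w.length) f
    · intro g _
      exact Fin.tail_cons (α := fun _ : Fin (w.length + 1) => ℕ+) _ g
    · intro f hf
      simp only [Finset.mem_filter] at hf
      have h : ((f ⟨0, by simp⟩ : ℕ) : ℝ) = M + 1 := by exact_mod_cast hf.2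
      rw [← h]
      exact Fin.prod_univ_succ (n := w.length) _
  · refine Finset.sum_congr (Finset.ext fun f => ?_) fun _ _ => rfl
    simp only [Finset.mem_filter, mem_strictBox]
    constructor
    · rintro ⟨⟨h1, h2⟩, h3⟩
      refine ⟨fun i => ?_, h2⟩
      have h4 := h1 ⟨0, by simp⟩
      have h5 : f ⟨0, by simp⟩ ≤ f i := h2.monotone (Fin.zero_le (n := w.length + 1) i)
      rw [← PNat.coe_le_coe] at h5
      have := h1 i
      omega
    · rintro ⟨h1, h2⟩
      refine ⟨⟨fun i => ?_, h2⟩, ?_⟩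
      · have := h1 i
        omega
      · have := h1 ⟨0, by simp⟩
        omega

lemma sum_strictBox_nil (M n : ℕ) :
    ∑ f ∈ strictBox M n ([] : List ℕ).length, mzvTerm [] f = 1 := by
  have h : strictBox M n ([] : List ℕ).length = {Fin.elim0} := by
    ext f
    simp only [mem_strictBox, Finset.mem_singleton]
    exact ⟨fun _ => funext fun i => i.elim0, fun _ => ⟨fun i => i.elim0, fun i => i.elim0⟩⟩
  rw [h, Finset.sum_singleton]
  simp [mzvTerm]

lemma truncSum_range' (M n : ℕ) (l : List ℕ) :
    truncSum 0 ((List.range' M n).map fun i : ℕ => ((0 : ℂ) + (i + 1))⁻¹) l =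
      ((∑ f ∈ strictBox M n l.length, mzvTerm l f : ℝ) : ℂ) := by
  induction n generalizing M l with
  | zero =>
    rcases l with _ | ⟨k, w⟩
    · rw [sum_strictBox_nil]; simp
    · have h : strictBox M 0 (k :: w).length = ∅ := by
        refine Finset.eq_empty_of_forall_notMem fun f hf => ?_
        have := (mem_strictBox.1 hf).1 ⟨0, by simp⟩
        omega
      rw [h]
      simp [truncSum, expOnes, onesFun]
  | succ n ih =>
    rcases l with _ | ⟨k, w⟩
    · rw [sum_strictBox_nil]; simp
    · rw [sum_strictBox_cons, List.range'_succ, List.map_cons, truncSum, ih, ih]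
      push_cast
      simp

lemma MZV_eq_of_tendsto {l : List ℕ} {L : ℂ}
    (h : Tendsto (fun N => truncSum 0 (shiftPts N 0) l) atTop (𝓝 L)) : (MZV l : ℂ) = L := by
  classical
  have e : ∀ N, truncSum 0 (shiftPts N 0) l =
      ((∑ f ∈ strictBox 0 N l.length, mzvTerm l f : ℝ) : ℂ) := fun N => by
    rw [← truncSum_range', shiftPts, List.range_eq_range']
  simp only [e] at h
  have hre : Tendsto (fun N => ∑ f ∈ strictBox 0 N l.length, mzvTerm l f) atTop (𝓝 L.re) := by
    exact (Complex.continuous_re.tendsto L).comp h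
  have hmono : Monotone fun N => strictBox 0 N l.length := by
    intro a b hab f hf
    rw [mem_strictBox] at hf ⊢
    exact ⟨fun i => ⟨(hf.1 i).1, (hf.1 i).2.trans (by omega)⟩, hf.2⟩
  set S : ℕ → Finset {f : Fin l.length → ℕ+ // StrictMono f} := fun N =>
    (strictBox 0 N l.length).subtype StrictMono with hS
  have hsum : ∀ N, ∑ f ∈ S N, mzvTerm l f.1 = ∑ f ∈ strictBox 0 N l.length, mzvTerm l f := by
    intro N
    refine Finset.sum_subtype_of_mem (p := StrictMono) (mzvTerm l) fun f hf => ?_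
    exact (mem_strictBox.1 hf).2
  have hSm : Monotone S := fun a b hab => Finset.subtype_mono (hmono hab)
  have hSmem : ∀ f, ∃ N, f ∈ S N := by
    intro f
    refine ⟨∑ i, (f.1 i : ℕ), ?_⟩
    rw [hS, Finset.mem_subtype, mem_strictBox]
    refine ⟨fun i => ⟨by have := (f.1 i).pos; omega, ?_⟩, f.2⟩
    rw [zero_add]
    exact Finset.single_le_sum (f := fun i => (f.1 i : ℕ)) (fun _ _ => Nat.zero_le _)
      (Finset.mem_univ i)
  have hStop : Tendsto S atTop atTop := tendsto_atTop_finset_of_monotone hSm hSmem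
  have hbound : ∀ u : Finset {f : Fin l.length → ℕ+ // StrictMono f},
      ∑ f ∈ u, mzvTerm l f.1 ≤ L.re := by
    intro u
    obtain ⟨N, hN⟩ := (hStop.eventually_ge_atTop u).exists
    refine (Finset.sum_le_sum_of_subset_of_nonneg hN fun f _ _ => mzvTerm_nonneg l f.1).trans ?_
    rw [hsum]
    refine Monotone.ge_of_tendsto (fun a b hab => ?_) hre N
    exact Finset.sum_le_sum_of_subset_of_nonneg (hmono hab) fun f _ _ => mzvTerm_nonneg l f
  have hs : Summable fun f : {f : Fin l.length → ℕ+ // StrictMono f} => mzvTerm l f.1 :=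
    summable_of_sum_le (fun f => mzvTerm_nonneg l f.1) hbound
  have h1 : Tendsto (fun N => ∑ f ∈ S N, mzvTerm l f.1) atTop (𝓝 (MZV l)) :=
    hs.hasSum.comp hStop
  simp only [hsum] at h1
  have h2 : Tendsto (fun N => ((∑ f ∈ strictBox 0 N l.length, mzvTerm l f : ℝ) : ℂ)) atTop
      (𝓝 (MZV l : ℂ)) := (Complex.continuous_ofReal.tendsto _).comp h1
  exact tendsto_nhds_unique h2 h

end MultipleZetaValue

section ShiftedValues

open Filter Topology

/-- The regularized multiple zeta value of Hurwitz type with denominators `m + z`, in which the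
harmonic series is regularized to `T`. -/
noncomputable def shiftMZV (T : ℂ) (w : List ℕ) (z : ℂ) : ℂ :=
  limUnder atTop fun N => truncSum (T - harmonicSum N) (shiftPts N z) w

variable {T : ℂ}

lemma tendstoLocallyUniformlyOn_shiftMZV {c : ℕ → ℂ} (hc : IsCounterterm T c) {w : List ℕ}
    (hw : PosWord w) :
    TendstoLocallyUniformlyOn (fun N z => truncSum (c N) (shiftPts N z) w) (shiftMZV T w) atTop
      polesCompl := by
  obtain ⟨L, hL⟩ := exists_tendstoLocallyUniformlyOn_truncSum T w hw
  refine (hL c hc).congr_right fun z hz => ?_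
  exact ((hL _ (isCounterterm_sub T)).tendsto_at hz).limUnder_eq.symm

lemma tendsto_shiftMZV {c : ℕ → ℂ} (hc : IsCounterterm T c) {w : List ℕ} (hw : PosWord w)
    {z : ℂ} (hz : z ∈ polesCompl) :
    Tendsto (fun N => truncSum (c N) (shiftPts N z) w) atTop (𝓝 (shiftMZV T w z)) :=
  (tendstoLocallyUniformlyOn_shiftMZV hc hw).tendsto_at hz

lemma posWord_of_mem_stuffle (u v : List ℕ) (hu : PosWord u) (hv : PosWord v) :
    ∀ x ∈ stuffle u v, PosWord x := by
  induction u generalizing v with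
  | nil => simpa [stuffle]
  | cons a u ihu =>
    induction v with
    | nil => simpa [stuffle]
    | cons b v ihv =>
      obtain ⟨ha, hu'⟩ := posWord_cons.1 hu
      obtain ⟨hb, hv'⟩ := posWord_cons.1 hv
      intro x hx
      simp only [stuffle, Multiset.mem_add, Multiset.mem_map] at hx
      obtain (⟨y, hy, rfl⟩ | ⟨y, hy, rfl⟩) | ⟨y, hy, rfl⟩ := hx
      · exact posWord_cons.2 ⟨ha, ihu _ hu' hv y hy⟩
      · exact posWord_cons.2 ⟨hb, ihv hv' y hy⟩
      · exact posWord_cons.2 ⟨by omega, ihu _ hu' hv' y hy⟩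

lemma shiftMZV_nil (z : ℂ) : shiftMZV T [] z = 1 := by
  simp only [shiftMZV, truncSum_nil]
  exact tendsto_const_nhds.limUnder_eq

lemma isStuffleChar_shiftMZV {z : ℂ} (hz : z ∈ polesCompl) :
    IsStuffleChar fun w => shiftMZV T w z where
  nil := shiftMZV_nil z
  mul u v hu hv := by
    have hc := isCounterterm_sub T
    have h1 := (tendsto_shiftMZV hc hu hz).mul (tendsto_shiftMZV hc hv hz)
    have h2 := tendsto_multiset_sum (stuffle u v) fun x hx =>
      tendsto_shiftMZV hc (posWord_of_mem_stuffle u v hu hv x hx) hz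
    refine tendsto_nhds_unique h1 (h2.congr fun N => ?_)
    exact ((isStuffleChar_truncSum _ _).mul u v hu hv).symm

lemma shiftMZV_one {z : ℂ} (hz : z ∈ polesCompl) :
    shiftMZV T [1] z = T + ∑' n : ℕ, ((z + (n + 1))⁻¹ - ((n : ℂ) + 1)⁻¹) :=
  tendsto_nhds_unique (tendsto_shiftMZV (isCounterterm_sub T) (by simp [PosWord]) hz)
    ((tendstoLocallyUniformlyOn_truncSum_one (isCounterterm_sub T)).tendsto_at hz)

lemma shiftMZV_append_singleton {w : List ℕ} (hw : PosWord w) {k : ℕ} (hk : 2 ≤ k) {z : ℂ}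
    (hz : z ∈ polesCompl) : shiftMZV T (w ++ [k]) z =
      ∑' n : ℕ, truncSum 0 (shiftPts n z) w * (z + (n + 1))⁻¹ ^ k :=
  tendsto_nhds_unique (tendsto_shiftMZV (isCounterterm_sub T)
      (posWord_append.2 ⟨hw, by simp [PosWord]; omega⟩) hz)
    ((tendstoLocallyUniformlyOn_truncSum_admissible w hw hk _).tendsto_at hz)

lemma zero_mem_polesCompl : (0 : ℂ) ∈ polesCompl := fun n => by
  rw [zero_add]
  exact_mod_cast n.succ_ne_zero

lemma IsStuffleReg.isStuffleChar {Z : List ℕ → ℝ} (hZ : IsStuffleReg Z) :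
    IsStuffleChar fun w => (Z w : ℂ) where
  nil := by simp [hZ.empty]
  mul u v hu hv := by
    rw [← Complex.ofReal_mul, hZ.mul u v hu hv, stuffleSum]
    induction stuffle u v using Multiset.induction_on with
    | empty => simp
    | cons a s ih => simp [ih]

lemma shiftMZV_zero {Z : List ℕ → ℝ} (hZ : IsStuffleReg Z) {w : List ℕ} (hw : PosWord w) :
    shiftMZV (Z [1]) w 0 = Z w := by
  refine (isStuffleChar_shiftMZV zero_mem_polesCompl).ext_of_admissible hZ.isStuffleChar ?_ ?_ w hw
  · simp [shiftMZV_one zero_mem_polesCompl]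
  · intro v k hv hk
    have hvk : PosWord (v ++ [k]) := posWord_append.2 ⟨hv, by simp [PosWord]; omega⟩
    rw [hZ.conv (v ++ [k]) hvk (by simpa using hk)]
    refine (MZV_eq_of_tendsto ?_).symm
    have h := tendsto_shiftMZV (isCounterterm_sub (Z [1])) hvk zero_mem_polesCompl
    simpa only [truncSum_append_singleton _ _ _ hk] using h

lemma TendstoLocallyUniformlyOn.derivSum {s : Set ℂ} {Φ : ℕ → ℂ → List ℕ → ℂ}
    {Ψ : ℂ → List ℕ → ℂ} (h : ∀ v, PosWord v →
      TendstoLocallyUniformlyOn (fun N z => Φ N z v) (fun z => Ψ z v) atTop s)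
    {w : List ℕ} (hw : PosWord w) :
    TendstoLocallyUniformlyOn (fun N z => derivSum (Φ N z) w) (fun z => derivSum (Ψ z) w)
      atTop s := by
  induction w generalizing Φ Ψ with
  | nil =>
    simpa [_root_.derivSum] using
      (tendsto_const_nhds.tendstoUniformlyOn_const s).tendstoLocallyUniformlyOn
  | cons k w ih =>
    obtain ⟨hk, hw⟩ := posWord_cons.1 hw
    simp only [_root_.derivSum]
    refine TendstoLocallyUniformlyOn.add ?_
      (ih (fun v hv => h (k :: v) (posWord_cons.2 ⟨hk, hv⟩)) hw)
    have h1 := h ((k + 1) :: w) (posWord_cons.2 ⟨k.succ_pos, hw⟩)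
    exact (uniformContinuous_const_smul (k : ℂ)).comp_tendstoLocallyUniformlyOn h1

lemma hasDerivAt_shiftMZV {w : List ℕ} (hw : PosWord w) {z : ℂ} (hz : z ∈ polesCompl) :
    HasDerivAt (shiftMZV T w) (-derivSum (fun v => shiftMZV T v z) w) z := by
  have hc := isCounterterm_sub T
  refine hasDerivAt_of_tendstoLocallyUniformlyOn (l := atTop) isOpen_polesCompl
    (f := fun N z => truncSum (T - harmonicSum N) (shiftPts N z) w)
    (f' := fun N z => -derivSum (truncSum (T - harmonicSum N) (shiftPts N z)) w)
    (g' := fun z => -derivSum (fun v => shiftMZV T v z) w) ?_ ?_ ?_ hz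
  · exact (TendstoLocallyUniformlyOn.derivSum
      (fun v hv => tendstoLocallyUniformlyOn_shiftMZV hc hv) hw).neg
  · exact Eventually.of_forall fun N z hz =>
      hasDerivAt_truncSum_map _ (List.range N) z (fun i _ => hz i) w
  · exact fun z hz => tendsto_shiftMZV hc hw hz

lemma add_one_mem_polesCompl {z : ℂ} (hz : z ∈ polesCompl) : z + 1 ∈ polesCompl := fun n => by
  have := hz (n + 1)
  push_cast at this
  rwa [add_assoc, add_comm (1 : ℂ)]

lemma shiftMZV_cons {k : ℕ} {w : List ℕ} (hw : PosWord (k :: w)) {z : ℂ} (hz : z ∈ polesCompl) :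
    shiftMZV T (k :: w) z =
      shiftMZV T (k :: w) (z + 1) + (z + 1)⁻¹ ^ k * shiftMZV T w (z + 1) := by
  set c : ℕ → ℂ := fun N => T - harmonicSum N
  have hc : IsCounterterm T c := isCounterterm_sub T
  have hz' := add_one_mem_polesCompl hz
  have hc' : IsCounterterm T fun N => c (N + 1) := by
    have h0 : Tendsto (fun N : ℕ => ((harmonicSum N : ℂ)) - harmonicSum (N + 1)) atTop (𝓝 0) := by
      have h1 : Tendsto (fun N : ℕ => -((1 : ℝ) / ((N : ℝ) + 1))) atTop (𝓝 0) := by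
        simpa using (tendsto_one_div_add_atTop_nhds_zero_nat (𝕜 := ℝ)).neg
      have h2 := (Complex.continuous_ofReal.tendsto _).comp h1
      refine (h2.congr fun N => ?_).trans_eq ?_
      · simp [harmonicSum, Finset.sum_range_succ]
      · simp
    refine (h0.const_add T).congr' ?_ |>.trans_eq (by simp)
    exact Eventually.of_forall fun N => by simp [c]; ring
  have h1 := (tendsto_add_atTop_iff_nat 1).2 (tendsto_shiftMZV hc hw hz)
  have h2 := (tendsto_shiftMZV hc' hw hz').add
    ((tendsto_shiftMZV hc' (posWord_cons.1 hw).2 hz').const_mul ((z + 1)⁻¹ ^ k))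
  refine tendsto_nhds_unique h1 (h2.congr fun N => ?_)
  have e : shiftPts (N + 1) z = (z + 1)⁻¹ :: shiftPts N (z + 1) := by
    simp only [shiftPts, List.range_succ_eq_map, List.map_cons, List.map_map, List.cons.injEq]
    refine ⟨by simp, List.map_congr_left fun i _ => ?_⟩
    simp only [Function.comp_apply]
    push_cast
    ring
  rw [e, truncSum]
  ring

end ShiftedValues

section Asymptotic

open Filter Topology Asymptotics

/-- The filter of points in the strip `|Re z| ≤ r` with `|Im z| → ∞`. -/
def stripEnds (r : ℝ) : Filter ℂ := comap (fun z => |z.im|) atTop ⊓ 𝓟 {z | |z.re| ≤ r}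

/-- `f(z) = O(|Im z| ^ (α + ε))` for all `ε > 0`, along the filter `l`. -/
def GrowthLE (l : Filter ℂ) (α : ℝ) (f : ℂ → ℂ) : Prop :=
  ∀ ε : ℝ, 0 < ε → f =O[l] fun z => |z.im| ^ (α + ε)

lemma eventually_stripEnds {r : ℝ} (Y : ℝ) : ∀ᶠ z in stripEnds r, Y ≤ |z.im| ∧ |z.re| ≤ r :=
  (tendsto_comap.mono_left inf_le_left |>.eventually_ge_atTop Y).and
    (mem_inf_of_right (mem_principal_self _))

section Closure

variable {l : Filter ℂ} {α β : ℝ} {f g : ℂ → ℂ}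

lemma GrowthLE.add (hf : GrowthLE l α f) (hg : GrowthLE l α g) :
    GrowthLE l α fun z => f z + g z := fun ε hε => (hf ε hε).add (hg ε hε)

lemma GrowthLE.sub (hf : GrowthLE l α f) (hg : GrowthLE l α g) :
    GrowthLE l α fun z => f z - g z := fun ε hε => (hf ε hε).sub (hg ε hε)

lemma GrowthLE.const_mul (hf : GrowthLE l α f) (c : ℂ) : GrowthLE l α fun z => c * f z :=
  fun ε hε => (hf ε hε).const_mul_left c

lemma growthLE_zero : GrowthLE l α fun _ => 0 := fun _ _ => isBigO_zero _ _

lemma GrowthLE.sum {ι : Type*} {s : Finset ι} {F : ι → ℂ → ℂ}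
    (h : ∀ i ∈ s, GrowthLE l α (F i)) : GrowthLE l α fun z => ∑ i ∈ s, F i z :=
  fun ε hε => IsBigO.fun_sum fun i hi => h i hi ε hε

lemma GrowthLE.multisetSum {s : Multiset (List ℕ)} {F : List ℕ → ℂ → ℂ}
    (h : ∀ i ∈ s, GrowthLE l α (F i)) : GrowthLE l α fun z => (s.map fun i => F i z).sum := by
  induction s using Multiset.induction_on with
  | empty => simpa using growthLE_zero
  | cons a s ih =>
    simp only [Multiset.map_cons, Multiset.sum_cons]
    exact (h a (by simp)).add (ih fun i hi => h i (by simp [hi]))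

lemma GrowthLE.congr' (hf : GrowthLE l α f) (h : f =ᶠ[l] g) : GrowthLE l α g :=
  fun ε hε => (hf ε hε).congr' h EventuallyEq.rfl

lemma GrowthLE.mul (hf : GrowthLE l α f) (hg : GrowthLE l β g)
    (hl : ∀ᶠ z in l, 1 ≤ |z.im|) : GrowthLE l (α + β) fun z => f z * g z := by
  intro ε hε
  refine ((hf (ε / 2) (by linarith)).mul (hg (ε / 2) (by linarith))).congr' EventuallyEq.rfl ?_
  filter_upwards [hl] with z hz
  rw [← Real.rpow_add (by linarith)]
  congr 1
  ring

lemma GrowthLE.mono (hf : GrowthLE l α f) (h : α ≤ β) (hl : ∀ᶠ z in l, 1 ≤ |z.im|) :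
    GrowthLE l β f := by
  intro ε hε
  refine (hf ε hε).trans (IsBigO.of_bound 1 ?_)
  filter_upwards [hl] with z hz
  rw [one_mul, Real.norm_of_nonneg (by positivity), Real.norm_of_nonneg (by positivity)]
  exact Real.rpow_le_rpow_of_exponent_le hz (by linarith)

lemma growthLE_of_bound (C : ℝ) (h : ∀ᶠ z in l, ‖f z‖ ≤ C * |z.im| ^ α)
    (hl : ∀ᶠ z in l, 1 ≤ |z.im|) : GrowthLE l α f := by
  intro ε hε
  refine (IsBigO.of_bound (g := fun z : ℂ => |z.im| ^ α) C ?_).trans (IsBigO.of_bound 1 ?_)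
  · filter_upwards [h] with z hz
    rwa [Real.norm_of_nonneg (by positivity)]
  · filter_upwards [hl] with z hz
    rw [one_mul, Real.norm_of_nonneg (by positivity), Real.norm_of_nonneg (by positivity)]
    exact Real.rpow_le_rpow_of_exponent_le hz (by linarith)

lemma GrowthLE.tendsto_zero {r : ℝ} (hf : GrowthLE (stripEnds r) α f) (hα : α < 0) :
    Tendsto f (stripEnds r) (𝓝 0) := by
  refine (hf (-α / 2) (by linarith)).trans_tendsto ?_
  have h : Tendsto (fun z : ℂ => |z.im|) (stripEnds r) atTop := tendsto_comap.mono_left inf_le_left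
  have := (tendsto_rpow_neg_atTop (show 0 < -α / 2 by linarith)).comp h
  refine this.congr fun z => ?_
  simp only [Function.comp_apply]
  congr 1
  ring

end Closure

lemma eventually_bounds :
    ∀ᶠ z in stripEnds 2, 4 ≤ |z.im| ∧ z ∈ polesCompl ∧ ‖z‖ ≤ 2 * |z.im| ∧
      (∀ n : ℕ, ‖(z + (n + 1))⁻¹‖ ≤ 2 / (n + 1)) ∧ ∀ n : ℕ, ‖(z + (n + 1))⁻¹‖ ≤ |z.im|⁻¹ := by
  filter_upwards [eventually_stripEnds (r := 2) 4] with z ⟨hy, hx⟩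
  have him : ∀ n : ℕ, |z.im| ≤ ‖z + (n + 1)‖ := fun n => by
    simpa using Complex.abs_im_le_norm (z + (n + 1))
  have hre : ∀ n : ℕ, (n : ℝ) - 1 ≤ ‖z + (n + 1)‖ := fun n => by
    have h1 := Complex.abs_re_le_norm (z + (n + 1))
    have h2 : (z + (n + 1)).re = z.re + (n + 1) := by simp
    rw [h2] at h1
    have := (abs_le.1 hx).1
    linarith [le_abs_self (z.re + (n + 1))]
  have hpos : ∀ n : ℕ, 0 < ‖z + (n + 1)‖ := fun n => by linarith [him n]
  refine ⟨hy, fun n => norm_pos_iff.1 (hpos n), ?_, fun n => ?_, fun n => ?_⟩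
  · linarith [Complex.norm_le_abs_re_add_abs_im z]
  · rw [norm_inv, inv_le_comm₀ (hpos n) (by positivity), inv_div]
    rcases le_total (n : ℝ) 3 with h | h
    · linarith [him n]
    · linarith [hre n]
  · rw [norm_inv]
    exact inv_anti₀ (by linarith) (him n)

lemma eventually_one_le : ∀ᶠ z in stripEnds 2, 1 ≤ |z.im| :=
  eventually_bounds.mono fun z hz => by linarith [hz.1]

variable {T : ℂ}

lemma growthLE_shiftMZV_append_singleton {w : List ℕ} (hw : PosWord w) {k : ℕ} (hk : 2 ≤ k) :
    GrowthLE (stripEnds 2) (-1 / 2) (shiftMZV T (w ++ [k])) := by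
  refine growthLE_of_bound (2 ^ (w.sum + k) * ∑' n : ℕ, harmonicSum n ^ w.length *
    (((n : ℝ) + 1) ^ (3 / 2 : ℝ))⁻¹) ?_ eventually_one_le
  filter_upwards [eventually_bounds] with z ⟨hy, hz, _, h2, h3⟩
  have hB : ∀ n : ℕ, √‖(z + (n + 1))⁻¹‖ ≤ |z.im| ^ (-1 / 2 : ℝ) := fun n => by
    refine (Real.sqrt_le_sqrt (h3 n)).trans (le_of_eq ?_)
    rw [Real.sqrt_eq_rpow, ← Real.rpow_neg_one, ← Real.rpow_mul (abs_nonneg _)]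
    norm_num
  rw [shiftMZV_append_singleton hw hk hz]
  refine (tsum_of_norm_bounded ((summable_harmonicSum_pow w.length).hasSum.mul_left
    (|z.im| ^ (-1 / 2 : ℝ) * 2 ^ (w.sum + k))) fun n =>
      norm_truncSum_term_le one_le_two h2 hB w hw hk n).trans (le_of_eq ?_)
  ring

lemma growthLE_shiftMZV_one : GrowthLE (stripEnds 2) 0 (shiftMZV T [1]) := by
  suffices h : ∀ ε : ℝ, 0 < ε → ε < 1 → GrowthLE (stripEnds 2) ε (shiftMZV T [1]) by
    intro ε hε
    have h1 := h (min (ε / 2) (1 / 2)) (by positivity)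
      ((min_le_right _ _).trans_lt (by norm_num)) (ε - min (ε / 2) (1 / 2))
      (by linarith [min_le_left (ε / 2) (1 / 2)])
    simpa using h1
  intro ε hε hε1
  have hs : Summable fun n : ℕ => (((n : ℝ) + 1) ^ (1 + ε))⁻¹ := by
    have h := (summable_nat_add_iff 1).2
      (Real.summable_nat_rpow_inv.2 (show (1 : ℝ) < 1 + ε by linarith))
    simpa using h
  refine growthLE_of_bound (‖T‖ + 2 * 2 ^ ε * ∑' n : ℕ, (((n : ℝ) + 1) ^ (1 + ε))⁻¹) ?_
    eventually_one_le
  filter_upwards [eventually_bounds] with z ⟨hy, hz, h1, h2, h3⟩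
  have hy0 : 0 < |z.im| := by linarith
  rw [shiftMZV_one hz, add_mul]
  refine (norm_add_le _ _).trans (add_le_add ?_ ?_)
  · exact le_mul_of_one_le_right (norm_nonneg _) (Real.one_le_rpow (by linarith) hε.le)
  · refine (tsum_of_norm_bounded (hs.hasSum.mul_left (2 * |z.im| ^ ε * 2 ^ ε)) fun n =>
      ?_).trans (le_of_eq (by ring))
    have hn0 : (0 : ℝ) < n + 1 := by positivity
    have h0 : (n : ℂ) + 1 ≠ 0 := by exact_mod_cast n.succ_ne_zero
    have e : (z + (n + 1))⁻¹ - ((n : ℂ) + 1)⁻¹ = -(z * (z + (n + 1))⁻¹ * ((n : ℂ) + 1)⁻¹) := by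
      have := hz n
      field_simp
      ring
    have h4 : ‖(n : ℂ) + 1‖ = n + 1 := by exact_mod_cast Complex.norm_natCast (n + 1)
    rw [e, norm_neg, norm_mul, norm_mul, norm_inv ((n : ℂ) + 1), h4]
    set x := ‖(z + (n + 1))⁻¹‖
    have hx0 : 0 ≤ x := norm_nonneg _
    have h5 : x ≤ |z.im| ^ (ε - 1) * (2 ^ ε * (((n : ℝ) + 1) ^ ε)⁻¹) := by
      have h6 : x ^ (1 - ε) ≤ |z.im| ^ (ε - 1) := by
        refine (Real.rpow_le_rpow hx0 (h3 n) (by linarith)).trans (le_of_eq ?_)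
        rw [← Real.rpow_neg_one, ← Real.rpow_mul hy0.le]
        congr 1
        ring
      have h7 : x ^ ε ≤ 2 ^ ε * (((n : ℝ) + 1) ^ ε)⁻¹ := by
        refine (Real.rpow_le_rpow hx0 (h2 n) hε.le).trans (le_of_eq ?_)
        rw [Real.div_rpow (by norm_num) hn0.le, div_eq_mul_inv]
      calc x = x ^ (1 - ε) * x ^ ε := by
            rw [← Real.rpow_add_of_nonneg hx0 (by linarith) hε.le]
            simp
        _ ≤ _ := mul_le_mul h6 h7 (by positivity) (by positivity)
    calc ‖z‖ * x * ((n : ℝ) + 1)⁻¹ ≤ 2 * |z.im| *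
          (|z.im| ^ (ε - 1) * (2 ^ ε * (((n : ℝ) + 1) ^ ε)⁻¹)) * ((n : ℝ) + 1)⁻¹ := by gcongr
      _ = 2 * (|z.im| * |z.im| ^ (ε - 1)) * 2 ^ ε * ((n + 1) * ((n : ℝ) + 1) ^ ε)⁻¹ := by
        rw [mul_inv]; ring
      _ = _ := by
        rw [← Real.rpow_one_add' hy0.le (by linarith), ← Real.rpow_one_add' hn0.le (by linarith)]
        congr 4
        ring

lemma growthLE_shiftMZV {w : List ℕ} (hw : PosWord w) :
    GrowthLE (stripEnds 2) 0 (shiftMZV T w) ∧ GrowthLE (stripEnds 2) (-1 / 2)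
      fun z => shiftMZV T w z - expOnes (shiftMZV T [1] z) w := by
  have hl := eventually_one_le
  refine stuffle_induction (P := fun w => GrowthLE (stripEnds 2) 0 (shiftMZV T w) ∧
    GrowthLE (stripEnds 2) (-1 / 2) fun z => shiftMZV T w z - expOnes (shiftMZV T [1] z) w)
    ?_ ?_ ?_ w hw
  · refine ⟨growthLE_of_bound 1 ?_ hl, ?_⟩
    · simp [shiftMZV_nil]
    · simpa [shiftMZV_nil, expOnes_nil] using growthLE_zero
  · intro v k hv hk
    have h := growthLE_shiftMZV_append_singleton (T := T) hv hk
    refine ⟨h.mono (by norm_num) hl, ?_⟩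
    simpa only [expOnes_append_singleton _ _ hk, sub_zero] using h
  · intro u w n rest hu h hPu hrest
    have h1 := growthLE_shiftMZV_one (T := T)
    have hev : ∀ᶠ z in stripEnds 2, z ∈ polesCompl := eventually_bounds.mono fun z hz => hz.2.1
    constructor
    · have h2 := ((hPu.1.mul h1 hl).mono (β := 0) (by norm_num) hl).sub
        (GrowthLE.multisetSum fun x hx => (hrest x hx).1)
      refine (h2.const_mul ((n : ℂ) + 1)⁻¹).congr' ?_
      filter_upwards [hev] with z hz
      exact ((isStuffleChar_shiftMZV hz).eq_of_stuffle hu h).symm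
    · have h2 := ((hPu.2.mul h1 hl).mono (β := -1 / 2) (by norm_num) hl).sub
        (GrowthLE.multisetSum fun x hx => (hrest x hx).2)
      refine (h2.const_mul ((n : ℂ) + 1)⁻¹).congr' ?_
      filter_upwards [hev] with z hz
      rw [(isStuffleChar_shiftMZV hz).eq_of_stuffle hu h,
        (isStuffleChar_expOnes (shiftMZV T [1] z)).eq_of_stuffle hu h, expOnes_one,
        Multiset.sum_map_sub]
      ring

end Asymptotic

section Reflection

open Filter Topology Asymptotics

variable {T : ℂ}

/-- The reflected Hurwitz type multiple zeta value `(-1)^|u| ζ(rev u; -z)`. -/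
noncomputable def reflMZV (T : ℂ) (u : List ℕ) (z : ℂ) : ℂ :=
  (-1) ^ u.sum * shiftMZV T u.reverse (-z)

/-- The regularized bilateral multiple sum over `⋯ < m₁ < ⋯ < m_d < ⋯` of `∏ (z + m_i)^{-k_i}`. -/
noncomputable def bilateralMZV (T : ℂ) (w : List ℕ) (z : ℂ) : ℂ :=
  ∑ i ∈ Finset.range (w.length + 1), reflMZV T (w.take i) (z + 1) * shiftMZV T (w.drop i) z

lemma expOnes_reverse (c : ℂ) (u : List ℕ) :
    (-1) ^ u.sum * expOnes c u.reverse = expOnes (-c) u := by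
  by_cases h : ∀ i ∈ u, i = 1
  · have hs : u.sum = u.length := by
      rw [List.eq_replicate_of_mem h]
      simp
    have hr : ∀ i ∈ u.reverse, i = 1 := fun i hi => h i (List.mem_reverse.1 hi)
    rw [expOnes, expOnes, onesFun, onesFun, if_pos h, if_pos hr, hs, List.length_reverse,
      neg_pow c]
    ring
  · have hr : ¬∀ i ∈ u.reverse, i = 1 := fun h' => h fun i hi => h' i (List.mem_reverse.2 hi)
    rw [expOnes, expOnes, onesFun, onesFun, if_neg h, if_neg hr, mul_zero]

lemma tendsto_reflection_stripEnds :
    Tendsto (fun z : ℂ => -(z + 1)) (stripEnds 1) (stripEnds 2) := by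
  refine tendsto_inf.2 ⟨tendsto_comap_iff.2 ?_, tendsto_principal.2 ?_⟩
  · refine (tendsto_comap.mono_left inf_le_left : Tendsto (fun z : ℂ => |z.im|) (stripEnds 1)
      atTop).congr fun z => ?_
    simp only [Function.comp_apply, Complex.neg_im, Complex.add_im, Complex.one_im, add_zero,
      abs_neg]
  · filter_upwards [eventually_stripEnds (r := 1) 0] with z hz
    have := abs_le.1 hz.2
    simp only [Complex.neg_re, Complex.add_re, Complex.one_re, abs_neg]
    exact abs_le.2 ⟨by linarith, by linarith⟩

lemma stripEnds_one_le_two : stripEnds 1 ≤ stripEnds 2 :=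
  inf_le_inf_left _ (principal_mono.2 fun z (hz : |z.re| ≤ 1) => hz.trans (by norm_num))

lemma GrowthLE.comp_reflection {α : ℝ} {f : ℂ → ℂ} (hf : GrowthLE (stripEnds 2) α f) :
    GrowthLE (stripEnds 1) α fun z => f (-(z + 1)) := by
  intro ε hε
  refine ((hf ε hε).comp_tendsto tendsto_reflection_stripEnds).congr_right fun z => ?_
  simp only [Function.comp_apply, Complex.neg_im, Complex.add_im, Complex.one_im, add_zero,
    abs_neg]

lemma growthLE_reflMZV {u : List ℕ} (hu : PosWord u) :
    GrowthLE (stripEnds 1) 0 (fun z => reflMZV T u (z + 1)) ∧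
      GrowthLE (stripEnds 1) (-1 / 2) fun z =>
        reflMZV T u (z + 1) - expOnes (-shiftMZV T [1] (-(z + 1))) u := by
  have h := growthLE_shiftMZV (T := T) hu.reverse
  refine ⟨h.1.comp_reflection.const_mul _, ?_⟩
  refine (h.2.comp_reflection.const_mul ((-1) ^ u.sum)).congr' (Eventually.of_forall fun z => ?_)
  simp only [reflMZV]
  rw [← expOnes_reverse]
  ring

lemma tendsto_bilateralMZV_sub {w : List ℕ} (hw : PosWord w) :
    Tendsto (fun z => bilateralMZV T w z -
      expOnes (shiftMZV T [1] z - shiftMZV T [1] (-(z + 1))) w) (stripEnds 1) (𝓝 0) := by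
  have hl : ∀ᶠ z in stripEnds 1, 1 ≤ |z.im| := eventually_one_le.filter_mono stripEnds_one_le_two
  refine GrowthLE.tendsto_zero (α := -1 / 2) ?_ (by norm_num)
  have key : ∀ i ∈ Finset.range (w.length + 1), GrowthLE (stripEnds 1) (-1 / 2) fun z =>
      reflMZV T (w.take i) (z + 1) * shiftMZV T (w.drop i) z -
        expOnes (-shiftMZV T [1] (-(z + 1))) (w.take i) *
          expOnes (shiftMZV T [1] z) (w.drop i) := by
    intro i _
    have h1 := growthLE_reflMZV (T := T) (hw.take i)
    have h2 := growthLE_shiftMZV (T := T) (hw.drop i)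
    have h3 : GrowthLE (stripEnds 1) 0 (shiftMZV T (w.drop i)) := fun ε hε =>
      (h2.1 ε hε).mono stripEnds_one_le_two
    have h4 : GrowthLE (stripEnds 1) (-1 / 2) fun z =>
        shiftMZV T (w.drop i) z - expOnes (shiftMZV T [1] z) (w.drop i) := fun ε hε =>
      (h2.2 ε hε).mono stripEnds_one_le_two
    have h5 := h1.1.sub (h1.2.mono (by norm_num) hl)
    have h6 := ((h1.2.mul h3 hl).mono (β := -1 / 2) (by norm_num) hl).add
      ((h5.mul h4 hl).mono (β := -1 / 2) (by norm_num) hl)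
    refine h6.congr' (Eventually.of_forall fun z => ?_)
    ring
  refine (GrowthLE.sum key).congr' (Eventually.of_forall fun z => ?_)
  simp only [bilateralMZV]
  rw [Finset.sum_sub_distrib, sum_expOnes_take_drop]
  congr 2
  ring

lemma mem_polesCompl_of_integerComplement {z : ℂ} (hz : z ∈ Complex.integerComplement) :
    z ∈ polesCompl := fun n h => hz ⟨-((n : ℤ) + 1), by push_cast; linear_combination -h⟩

lemma neg_mem_integerComplement {z : ℂ} (hz : z ∈ Complex.integerComplement) :
    -z ∈ Complex.integerComplement := fun ⟨n, hn⟩ =>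
  hz ⟨-n, by push_cast; linear_combination -hn⟩

lemma add_int_mem_integerComplement {z : ℂ} (hz : z ∈ Complex.integerComplement) (m : ℤ) :
    z + m ∈ Complex.integerComplement := fun ⟨n, hn⟩ =>
  hz ⟨n - m, by push_cast; linear_combination hn⟩

lemma summable_inv_sub_inv {z : ℂ} (hz : z ∈ polesCompl) :
    Summable fun n : ℕ => (z + (n + 1))⁻¹ - ((n : ℂ) + 1)⁻¹ := by
  obtain ⟨A, _, h⟩ := exists_bound_nhds hz
  exact Summable.of_norm_bounded (summable_sq_inv.mul_left (‖z‖ * A)) fun n =>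
    norm_inv_sub_inv_le hz h.self_of_nhds.2 n

lemma shiftMZV_one_sub_reflection {z : ℂ} (hz : z ∈ Complex.integerComplement) :
    shiftMZV T [1] z - shiftMZV T [1] (-(z + 1)) = π * Complex.cot (π * z) := by
  have hz1 := mem_polesCompl_of_integerComplement hz
  have hz2 := mem_polesCompl_of_integerComplement (neg_mem_integerComplement hz)
  have hz3 : -(z + 1) ∈ polesCompl := by
    refine mem_polesCompl_of_integerComplement (neg_mem_integerComplement ?_)
    simpa using add_int_mem_integerComplement hz 1
  have h1 := shiftMZV_cons (T := T) (k := 1) (w := []) (by simp [PosWord]) hz3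
  have e : -(z + 1) + 1 = -z := by ring
  rw [e, shiftMZV_nil, mul_one, pow_one] at h1
  rw [h1, shiftMZV_one hz1, shiftMZV_one hz2]
  have h2 := cot_series_rep' hz
  have h3 := (summable_inv_sub_inv hz1).tsum_sub (summable_inv_sub_inv hz2)
  have h4 : ∀ n : ℕ, (z + (n + 1))⁻¹ - ((n : ℂ) + 1)⁻¹ - ((-z + (n + 1))⁻¹ - ((n : ℂ) + 1)⁻¹) =
      1 / (z - (n + 1)) + 1 / (z + (n + 1)) := fun n => by
    have : (-z + ((n : ℂ) + 1))⁻¹ = -(1 / (z - (n + 1))) := by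
      rw [one_div, ← inv_neg]
      congr 1
      ring
    rw [this]
    ring
  simp only [h4] at h3
  rw [← h2] at h3
  have h5 : (-z)⁻¹ = -(1 / z) := by rw [one_div, inv_neg]
  rw [h5]
  linear_combination -h3

/-- The filter of points in the strip `|Re z| ≤ 1` with `Im z → ∞`. -/
def stripTop : Filter ℂ := comap Complex.im atTop ⊓ 𝓟 {z | |z.re| ≤ 1}

/-- The filter of points in the strip `|Re z| ≤ 1` with `Im z → -∞`. -/
def stripBot : Filter ℂ := comap Complex.im atBot ⊓ 𝓟 {z | |z.re| ≤ 1}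

lemma stripTop_le : stripTop ≤ stripEnds 1 :=
  inf_le_inf_right _ (tendsto_iff_comap.1 (tendsto_abs_atTop_atTop.comp tendsto_comap))

lemma stripBot_le : stripBot ≤ stripEnds 1 :=
  inf_le_inf_right _ (tendsto_iff_comap.1 (tendsto_abs_atBot_atTop.comp tendsto_comap))

lemma eventually_integerComplement : ∀ᶠ z in stripEnds 1, z ∈ Complex.integerComplement := by
  filter_upwards [eventually_stripEnds (r := 1) 1] with z hz
  rintro ⟨n, rfl⟩
  norm_num at hz

lemma tendsto_pi_mul_cot_stripTop :
    Tendsto (fun z : ℂ => π * Complex.cot (π * z)) stripTop (𝓝 (-(π * Complex.I))) := by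
  have h0 : Tendsto (fun z : ℂ => Complex.exp (2 * π * Complex.I * z)) stripTop (𝓝 0) := by
    refine Complex.tendsto_exp_comap_re_atBot.comp (tendsto_comap_iff.2 ?_)
    have h : Tendsto (fun z : ℂ => z.im * (-(2 * π))) stripTop atBot :=
      (tendsto_comap.mono_left inf_le_left).atTop_mul_const_of_neg (by linarith [Real.pi_pos])
    refine h.congr fun z => ?_
    simp
    ring
  have h1 : Tendsto (fun z : ℂ => π * ((Complex.exp (2 * π * Complex.I * z) + 1) /
      (Complex.I * (1 - Complex.exp (2 * π * Complex.I * z))))) stripTop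
      (𝓝 (π * ((0 + 1) / (Complex.I * (1 - 0))))) :=
    ((h0.add_const 1).div ((h0.const_sub 1).const_mul Complex.I) (by simp)).const_mul _
  refine (h1.congr fun z => by rw [Complex.cot_pi_eq_exp_ratio]).trans_eq ?_
  simp

lemma tendsto_pi_mul_cot_stripBot :
    Tendsto (fun z : ℂ => π * Complex.cot (π * z)) stripBot (𝓝 (π * Complex.I)) := by
  have h : Tendsto (fun z : ℂ => -z) stripBot stripTop := by
    refine tendsto_inf.2 ⟨tendsto_comap_iff.2 ?_, tendsto_principal.2 ?_⟩
    · exact tendsto_neg_atBot_atTop.comp (tendsto_comap.mono_left inf_le_left)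
    · have h2 : ∀ᶠ z in stripBot, |z.re| ≤ 1 := mem_inf_of_right (mem_principal_self _)
      filter_upwards [h2] with z hz
      simpa using hz
  have h1 := (tendsto_pi_mul_cot_stripTop.comp h).neg
  rw [neg_neg] at h1
  refine h1.congr fun z => ?_
  simp only [Function.comp_apply, Complex.cot, mul_neg, Complex.cos_neg, Complex.sin_neg, div_neg,
    neg_neg]

lemma tendsto_bilateralMZV {w : List ℕ} (hw : PosWord w) {l : Filter ℂ} (hl : l ≤ stripEnds 1)
    {c : ℂ} (hc : Tendsto (fun z : ℂ => π * Complex.cot (π * z)) l (𝓝 c)) :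
    Tendsto (bilateralMZV T w) l (𝓝 (expOnes c w)) := by
  have hcont : Continuous fun c => expOnes c w := by
    unfold expOnes onesFun
    split_ifs <;> fun_prop
  have h1 := ((tendsto_bilateralMZV_sub (T := T) hw).mono_left hl).add ((hcont.tendsto c).comp hc)
  rw [zero_add] at h1
  refine h1.congr' ?_
  filter_upwards [eventually_integerComplement.filter_mono hl] with z hz
  rw [Function.comp_apply, shiftMZV_one_sub_reflection hz, sub_add_cancel]

end Reflection

section Liouville

open Filter Topology Asymptotics Metric

instance : NeBot stripTop := by
  refine ((atTop_neBot (α := ℝ)).map fun y : ℝ => (y : ℂ) * Complex.I).mono ?_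
  refine tendsto_inf.2 ⟨tendsto_comap_iff.2 ?_, tendsto_principal.2 ?_⟩
  · exact tendsto_id.congr fun y => by simp
  · exact Eventually.of_forall fun y => by simp

instance : NeBot stripBot := by
  refine ((atBot_neBot (α := ℝ)).map fun y : ℝ => (y : ℂ) * Complex.I).mono ?_
  refine tendsto_inf.2 ⟨tendsto_comap_iff.2 ?_, tendsto_principal.2 ?_⟩
  · exact tendsto_id.congr fun y => by simp
  · exact Eventually.of_forall fun y => by simp

/-- A `1`-periodic entire function with limits at both ends of the strip is constant. -/
lemma eq_of_periodic_of_tendsto {f : ℂ → ℂ} (hf : Differentiable ℂ f)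
    (hp : ∀ z, f (z + 1) = f z) {a b : ℂ} (ha : Tendsto f stripTop (𝓝 a))
    (hb : Tendsto f stripBot (𝓝 b)) (z : ℂ) : f z = a ∧ f z = b := by
  have hbdd : Bornology.IsBounded (Set.range f) := by
    obtain ⟨Y₁, -, h₁⟩ := ((atTop_basis.comap Complex.im).inf_principal _).eventually_iff.1
      (ha.norm.eventually_le_const (lt_add_one ‖a‖))
    obtain ⟨Y₂, -, h₂⟩ := ((atBot_basis.comap Complex.im).inf_principal _).eventually_iff.1
      (hb.norm.eventually_le_const (lt_add_one ‖b‖))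
    obtain ⟨C, hC⟩ := ((isCompact_Icc (a := (-1 : ℝ)) (b := 1)).reProdIm
      (isCompact_Icc (a := Y₂) (b := Y₁))).exists_bound_of_continuousOn hf.continuous.continuousOn
    refine isBounded_iff_forall_norm_le.2 ⟨max (max (‖a‖ + 1) (‖b‖ + 1)) C, ?_⟩
    rintro _ ⟨z, rfl⟩
    have hper : ∀ n : ℤ, f (z - n) = f z := fun n => by
      simpa using (show Function.Periodic f 1 from hp).sub_zsmul_eq n (x := z)
    rw [← hper ⌊z.re⌋]
    set y := z - ⌊z.re⌋ with hy
    have hre : y.re = Int.fract z.re := by simp [hy]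
    have h0 : |y.re| ≤ 1 := by
      rw [hre, abs_of_nonneg (Int.fract_nonneg _)]
      exact (Int.fract_lt_one _).le
    rcases le_total Y₁ y.im with h | h
    · exact (h₁ ⟨h, h0⟩).trans (le_max_of_le_left (le_max_left _ _))
    rcases le_total y.im Y₂ with h' | h'
    · exact (h₂ ⟨h', h0⟩).trans (le_max_of_le_left (le_max_right _ _))
    · exact (hC y ⟨abs_le.1 h0, h', h⟩).trans (le_max_right _ _)
  have hconst : f = fun _ => f z := funext fun y => hf.apply_eq_apply_of_bounded hbdd y z
  rw [hconst] at ha hb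
  exact ⟨tendsto_nhds_unique tendsto_const_nhds ha, tendsto_nhds_unique tendsto_const_nhds hb⟩

lemma ball_inter_integerComplement {z : ℂ} (hz : z ∈ ball (0 : ℂ) 1) (h0 : z ≠ 0) :
    z ∈ Complex.integerComplement := by
  rintro ⟨n, rfl⟩
  rw [mem_ball_zero_iff, Complex.norm_intCast] at hz
  have : |n| < 1 := by exact_mod_cast hz
  exact h0 (by simp [Int.abs_lt_one_iff.1 this])

lemma isOpen_integerComplement : IsOpen Complex.integerComplement :=
  Complex.isOpen_compl_range_intCast

/-- A `1`-periodic function with removable singularities at the integers and limits at both ends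
of the strip has removable value equal to these limits. -/
lemma eq_of_periodic_of_removable {E R : ℂ → ℂ}
    (hE : DifferentiableOn ℂ E Complex.integerComplement)
    (hp : ∀ z ∈ Complex.integerComplement, E (z + 1) = E z)
    (hR : DifferentiableOn ℂ R (ball 0 1)) (hER : ∀ z ∈ ball (0 : ℂ) 1, z ≠ 0 → E z = R z)
    {a b : ℂ} (ha : Tendsto E stripTop (𝓝 a)) (hb : Tendsto E stripBot (𝓝 b)) :
    R 0 = a ∧ R 0 = b := by
  classical
  set f : ℂ → ℂ := fun z => if z ∈ Complex.integerComplement then E z else R 0 with hf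
  have h0 : (0 : ℂ) ∉ Complex.integerComplement := fun h => h ⟨0, by simp⟩
  have hfp : ∀ z, f (z + 1) = f z := fun z => by
    have := Complex.add_intCast_mem_integerComplement (x := z) 1
    push_cast at this
    by_cases hz : z ∈ Complex.integerComplement
    · simp only [hf, if_pos hz, if_pos (this.2 hz), hp z hz]
    · simp only [hf, if_neg hz, if_neg (this.not.2 hz)]
  have hball : ∀ z ∈ ball (0 : ℂ) 1, f z = R z := fun z hz => by
    rcases eq_or_ne z 0 with rfl | h
    · simp only [hf, if_neg h0]
    · simp only [hf, if_pos (ball_inter_integerComplement hz h), hER z hz h]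
  have hd : Differentiable ℂ f := fun z => by
    by_cases hz : z ∈ Complex.integerComplement
    · have hn := isOpen_integerComplement.mem_nhds hz
      refine (hE.differentiableAt hn).congr_of_eventuallyEq ?_
      filter_upwards [hn] with y hy
      simp only [hf, if_pos hy]
    · obtain ⟨n, rfl⟩ := not_not.1 hz
      have hper : ∀ y, f (y - n) = f y := fun y => by
        simpa using (show Function.Periodic f 1 from hfp).sub_zsmul_eq n (x := y)
      have h1 : DifferentiableAt ℂ f 0 :=
        (hR.differentiableAt (ball_mem_nhds 0 one_pos)).congr_of_eventuallyEq
          (Filter.mem_of_superset (ball_mem_nhds 0 one_pos) hball)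
      have h2 : DifferentiableAt ℂ (fun y => f (y - n)) n := by
        rw [← sub_self (n : ℂ)] at h1
        exact DifferentiableAt.comp (g := f) (f := fun y : ℂ => y - n) (n : ℂ) h1
          (differentiableAt_id.sub_const _)
      simpa only [hper] using h2
  have hev : ∀ᶠ z in stripEnds 1, E z = f z := by
    filter_upwards [eventually_integerComplement] with z hz
    simp only [hf, if_pos hz]
  have := eq_of_periodic_of_tendsto hd hfp (ha.congr' (hev.filter_mono stripTop_le))
    (hb.congr' (hev.filter_mono stripBot_le)) 0
  simpa only [hf, if_neg h0] using this

end Liouville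

section Taylor

open Metric

/-- The Taylor coefficients of `h` at the origin. -/
noncomputable def taylorCoeff (h : ℂ → ℂ) (m : ℕ) : ℂ := iteratedDeriv m h 0 / m.factorial

lemma taylorCoeff_dslope {h : ℂ → ℂ} (hh : DifferentiableOn ℂ h (ball 0 1)) (m : ℕ) :
    taylorCoeff (dslope h 0) m = taylorCoeff h (m + 1) := by
  have hn : ball (0 : ℂ) 1 ∈ nhds 0 := ball_mem_nhds 0 one_pos
  have h1 := (hh.analyticAt hn).hasFPowerSeriesAt
  have h2 := (((Complex.differentiableOn_dslope hn).2 hh).analyticAt hn).hasFPowerSeriesAt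
  have h3 := congrArg (fun p => p.coeff m)
    (h2.eq_formalMultilinearSeries h1.has_fpower_series_dslope_fslope)
  simpa [taylorCoeff] using h3

lemma exists_taylor_remainder (k : ℕ) {h : ℂ → ℂ} (hh : DifferentiableOn ℂ h (ball 0 1)) :
    ∃ q : ℂ → ℂ, DifferentiableOn ℂ q (ball 0 1) ∧ q 0 = taylorCoeff h k ∧
      ∀ z, h z = ∑ m ∈ Finset.range k, taylorCoeff h m * z ^ m + z ^ k * q z := by
  induction k generalizing h with
  | zero => exact ⟨h, hh, by simp [taylorCoeff], by simp⟩
  | succ k ih =>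
    have hn : ball (0 : ℂ) 1 ∈ nhds 0 := ball_mem_nhds 0 one_pos
    obtain ⟨q, h1, h2, h3⟩ := ih ((Complex.differentiableOn_dslope hn).2 hh)
    refine ⟨q, h1, by rw [h2, taylorCoeff_dslope hh], fun z => ?_⟩
    have h4 := sub_smul_dslope h 0 z
    rw [h3, sub_zero, smul_eq_mul] at h4
    rw [Finset.sum_range_succ']
    simp only [taylorCoeff_dslope hh] at h4
    have h5 : taylorCoeff h 0 = h 0 := by simp [taylorCoeff]
    rw [mul_add, Finset.mul_sum] at h4
    rw [h5]
    have h6 : ∑ m ∈ Finset.range k, taylorCoeff h (m + 1) * z ^ (m + 1) =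
        ∑ m ∈ Finset.range k, z * (taylorCoeff h (m + 1) * z ^ m) :=
      Finset.sum_congr rfl fun m _ => by ring
    rw [h6]
    linear_combination -h4

end Taylor

section Identity

open Filter Topology Metric

variable {T : ℂ}

lemma ball_subset_polesCompl : ball (0 : ℂ) 1 ⊆ polesCompl := fun z hz => by
  rcases eq_or_ne z 0 with rfl | h
  · exact zero_mem_polesCompl
  · exact mem_polesCompl_of_integerComplement (ball_inter_integerComplement hz h)

lemma differentiableOn_shiftMZV {w : List ℕ} (hw : PosWord w) :
    DifferentiableOn ℂ (shiftMZV T w) polesCompl := fun _ hz =>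
  (hasDerivAt_shiftMZV hw hz).differentiableAt.differentiableWithinAt

lemma differentiableOn_reflMZV {u : List ℕ} (hu : PosWord u) {s : Set ℂ}
    (hs : ∀ z ∈ s, -z ∈ polesCompl) : DifferentiableOn ℂ (reflMZV T u) s :=
  ((differentiableOn_shiftMZV hu.reverse).comp differentiableOn_id.neg hs).const_mul _

lemma neg_mem_polesCompl_of_ball {z : ℂ} (hz : z ∈ ball (0 : ℂ) 1) : -z ∈ polesCompl :=
  ball_subset_polesCompl (by simpa using hz)

lemma neg_mem_polesCompl {z : ℂ} (hz : z ∈ Complex.integerComplement) : -z ∈ polesCompl :=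
  mem_polesCompl_of_integerComplement (neg_mem_integerComplement hz)

lemma reflMZV_nil (z : ℂ) : reflMZV T [] z = 1 := by simp [reflMZV, shiftMZV_nil]

lemma reflMZV_append_singleton {u : List ℕ} {k : ℕ} (hu : PosWord (u ++ [k])) {z : ℂ}
    (hz : z ∈ Complex.integerComplement) :
    reflMZV T (u ++ [k]) (z + 1) = reflMZV T (u ++ [k]) z + z⁻¹ ^ k * reflMZV T u z := by
  have hz1 : -(z + 1) ∈ polesCompl :=
    neg_mem_polesCompl (by simpa using add_int_mem_integerComplement hz 1)
  have hu' := hu.reverse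
  have e : -(z + 1) + 1 = -z := by ring
  simp only [List.reverse_append, List.reverse_cons, List.reverse_nil, List.nil_append,
    List.cons_append] at hu'
  simp only [reflMZV, List.reverse_append, List.reverse_cons, List.reverse_nil, List.nil_append,
    List.cons_append, List.sum_append, List.sum_cons, List.sum_nil, add_zero]
  rw [shiftMZV_cons hu' hz1, e, pow_add, inv_neg, neg_pow z⁻¹]
  have : ((-1 : ℂ) ^ k) * (-1) ^ k = 1 := by rw [← mul_pow]; simp
  linear_combination (-1 : ℂ) ^ u.sum * z⁻¹ ^ k * shiftMZV T u.reverse (-z) * this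

lemma take_succ_eq_append_getD {w : List ℕ} {j : ℕ} (hj : j < w.length) :
    w.take (j + 1) = w.take j ++ [w.getD j 0] := by
  rw [List.take_add_one, List.getElem?_eq_getElem hj, List.getD_eq_getElem _ _ hj]
  rfl

lemma drop_eq_getD_cons {w : List ℕ} {j : ℕ} (hj : j < w.length) :
    w.drop j = w.getD j 0 :: w.drop (j + 1) := by
  rw [List.drop_eq_getElem_cons hj, List.getD_eq_getElem _ _ hj]

/-- The product `G_{k₁,…,k_j} F_{k_{j+2},…,k_d}` appearing at the pole of order `k_{j+1}`. -/
noncomputable def polarPart (T : ℂ) (w : List ℕ) (j : ℕ) (z : ℂ) : ℂ :=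
  reflMZV T (w.take j) z * shiftMZV T (w.drop (j + 1)) z

/-- The regular part of `bilateralMZV`. -/
noncomputable def regularPart (T : ℂ) (w : List ℕ) (z : ℂ) : ℂ :=
  ∑ i ∈ Finset.range (w.length + 1), reflMZV T (w.take i) z * shiftMZV T (w.drop i) z

lemma bilateralMZV_eq_regularPart_add {w : List ℕ} (hw : PosWord w) {z : ℂ}
    (hz : z ∈ Complex.integerComplement) :
    bilateralMZV T w z = regularPart T w z +
      ∑ j ∈ Finset.range w.length, z⁻¹ ^ w.getD j 0 * polarPart T w j z := by
  rw [bilateralMZV, regularPart, Finset.sum_range_succ', Finset.sum_range_succ' (n := w.length)]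
  simp only [List.take_zero, reflMZV_nil, List.drop_zero]
  rw [add_right_comm, ← Finset.sum_add_distrib]
  congr 1
  refine Finset.sum_congr rfl fun j hj => ?_
  have hj := Finset.mem_range.1 hj
  have hw' := hw.take (j + 1)
  rw [take_succ_eq_append_getD hj] at hw'
  rw [take_succ_eq_append_getD hj, reflMZV_append_singleton hw' hz, polarPart]
  ring

lemma bilateralMZV_add_one {w : List ℕ} (hw : PosWord w) {z : ℂ}
    (hz : z ∈ Complex.integerComplement) : bilateralMZV T w (z + 1) = bilateralMZV T w z := by
  have hz1 : z + 1 ∈ Complex.integerComplement := by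
    simpa using add_int_mem_integerComplement hz 1
  rw [bilateralMZV_eq_regularPart_add hw hz1, bilateralMZV, regularPart]
  rw [Finset.sum_range_succ, Finset.sum_range_succ (n := w.length)]
  rw [add_right_comm, ← Finset.sum_add_distrib, List.drop_length, shiftMZV_nil, shiftMZV_nil]
  congr 1
  refine Finset.sum_congr rfl fun j hj => ?_
  have hw' := hw.drop j
  rw [drop_eq_getD_cons (Finset.mem_range.1 hj)] at hw'
  rw [drop_eq_getD_cons (Finset.mem_range.1 hj),
    shiftMZV_cons hw' (mem_polesCompl_of_integerComplement hz), polarPart]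
  ring

lemma differentiableOn_bilateralMZV {w : List ℕ} (hw : PosWord w) :
    DifferentiableOn ℂ (bilateralMZV T w) Complex.integerComplement := by
  refine DifferentiableOn.fun_sum fun i _ => DifferentiableOn.mul ?_ ?_
  · refine DifferentiableOn.comp (g := reflMZV T (w.take i)) (f := fun z => z + 1)
      (t := Complex.integerComplement) (differentiableOn_reflMZV (hw.take i) fun z hz => neg_mem_polesCompl hz)
      (differentiableOn_id.add_const 1) fun z hz => ?_
    simpa using add_int_mem_integerComplement hz 1
  · exact (differentiableOn_shiftMZV (hw.drop i)).mono fun z hz =>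
      mem_polesCompl_of_integerComplement hz

lemma differentiableOn_regularPart {w : List ℕ} (hw : PosWord w) :
    DifferentiableOn ℂ (regularPart T w) (ball 0 1) :=
  DifferentiableOn.fun_sum fun i _ =>
    (differentiableOn_reflMZV (hw.take i) fun _ hz => neg_mem_polesCompl_of_ball hz).mul
      ((differentiableOn_shiftMZV (hw.drop i)).mono ball_subset_polesCompl)

lemma differentiableOn_polarPart {w : List ℕ} (hw : PosWord w) (j : ℕ) :
    DifferentiableOn ℂ (polarPart T w j) (ball 0 1) :=
  (differentiableOn_reflMZV (hw.take j) fun _ hz => neg_mem_polesCompl_of_ball hz).mul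
    ((differentiableOn_shiftMZV (hw.drop (j + 1))).mono ball_subset_polesCompl)

lemma bilateralMZV_singleton {n : ℕ} (hn : 0 < n) {z : ℂ} (hz : z ∈ Complex.integerComplement) :
    bilateralMZV T [n] z = regularPart T [n] z + z⁻¹ ^ n := by
  rw [bilateralMZV_eq_regularPart_add (by simpa [PosWord] using hn) hz]
  simp [polarPart, reflMZV_nil, shiftMZV_nil]

/-- Comparing the two expansions of the bilateral multiple sum. -/
lemma regularPart_zero {w : List ℕ} (hw : PosWord w) :
    regularPart T w 0 = (expOnes (π * Complex.I) w + expOnes (-(π * Complex.I)) w) / 2 +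
      ∑ j ∈ Finset.range w.length, (∑ m ∈ Finset.range (w.getD j 0),
        taylorCoeff (polarPart T w j) m * regularPart T [w.getD j 0 - m] 0 -
          taylorCoeff (polarPart T w j) (w.getD j 0)) := by
  have hpos : ∀ j ∈ Finset.range w.length, 0 < w.getD j 0 := fun j hj => by
    rw [List.getD_eq_getElem _ _ (Finset.mem_range.1 hj)]
    exact hw _ (List.getElem_mem _)
  have hsing : ∀ j, ∀ m ∈ Finset.range (w.getD j 0), PosWord [w.getD j 0 - m] := fun j m hm => by
    have := Finset.mem_range.1 hm
    simp only [PosWord, List.mem_singleton, forall_eq]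
    omega
  choose q hq1 hq2 hq3 using fun j =>
    exists_taylor_remainder (w.getD j 0) (differentiableOn_polarPart (T := T) hw j)
  have hlim : ∀ {l : Filter ℂ}, l ≤ stripEnds 1 → ∀ {c : ℂ},
      Tendsto (fun z : ℂ => π * Complex.cot (π * z)) l (𝓝 c) →
      Tendsto (fun z => bilateralMZV T w z - ∑ j ∈ Finset.range w.length,
        ∑ m ∈ Finset.range (w.getD j 0),
          taylorCoeff (polarPart T w j) m * bilateralMZV T [w.getD j 0 - m] z) l
        (𝓝 (expOnes c w - ∑ j ∈ Finset.range w.length, ∑ m ∈ Finset.range (w.getD j 0),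
          taylorCoeff (polarPart T w j) m * expOnes c [w.getD j 0 - m])) := by
    intro l hl c hc
    refine (tendsto_bilateralMZV hw hl hc).sub ?_
    refine tendsto_finsetSum _ fun j _ => tendsto_finsetSum _ fun m hm => ?_
    exact (tendsto_bilateralMZV (hsing j m hm) hl hc).const_mul _
  have key := eq_of_periodic_of_removable
    (E := fun z => bilateralMZV T w z - ∑ j ∈ Finset.range w.length,
      ∑ m ∈ Finset.range (w.getD j 0),
        taylorCoeff (polarPart T w j) m * bilateralMZV T [w.getD j 0 - m] z)
    (R := fun z => regularPart T w z + ∑ j ∈ Finset.range w.length, (q j z -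
      ∑ m ∈ Finset.range (w.getD j 0),
        taylorCoeff (polarPart T w j) m * regularPart T [w.getD j 0 - m] z))
    (a := expOnes (-(π * Complex.I)) w - ∑ j ∈ Finset.range w.length,
      ∑ m ∈ Finset.range (w.getD j 0),
        taylorCoeff (polarPart T w j) m * expOnes (-(π * Complex.I)) [w.getD j 0 - m])
    (b := expOnes (π * Complex.I) w - ∑ j ∈ Finset.range w.length,
      ∑ m ∈ Finset.range (w.getD j 0),
        taylorCoeff (polarPart T w j) m * expOnes (π * Complex.I) [w.getD j 0 - m])
    ?_ ?_ ?_ ?_ ?_ ?_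
  · have h1 : ∀ c : ℂ, ∀ j, ∀ m ∈ Finset.range (w.getD j 0),
        expOnes (-c) [w.getD j 0 - m] = -expOnes c [w.getD j 0 - m] := fun c j m hm => by
      simp only [expOnes, onesFun, List.mem_singleton, forall_eq, List.length_singleton]
      split_ifs <;> simp
    have h2 : ∑ j ∈ Finset.range w.length, ∑ m ∈ Finset.range (w.getD j 0),
        taylorCoeff (polarPart T w j) m * expOnes (-(π * Complex.I)) [w.getD j 0 - m] =
        -∑ j ∈ Finset.range w.length, ∑ m ∈ Finset.range (w.getD j 0),
        taylorCoeff (polarPart T w j) m * expOnes (π * Complex.I) [w.getD j 0 - m] := by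
      rw [← Finset.sum_neg_distrib]
      refine Finset.sum_congr rfl fun j _ => ?_
      rw [← Finset.sum_neg_distrib]
      refine Finset.sum_congr rfl fun m hm => ?_
      rw [h1 _ _ _ hm]
      ring
    obtain ⟨k1, k2⟩ := key
    rw [h2] at k1
    simp only [hq2, Finset.sum_sub_distrib] at k1 k2 ⊢
    linear_combination (k1 + k2) / 2
  · exact (differentiableOn_bilateralMZV hw).sub <| DifferentiableOn.fun_sum fun j _ =>
      DifferentiableOn.fun_sum fun m hm =>
        (differentiableOn_bilateralMZV (hsing j m hm)).const_mul _
  · intro z hz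
    simp only [bilateralMZV_add_one hw hz]
    rw [sub_right_inj]
    refine Finset.sum_congr rfl fun j _ => Finset.sum_congr rfl fun m hm => ?_
    rw [bilateralMZV_add_one (hsing j m hm) hz]
  · exact (differentiableOn_regularPart hw).add <| DifferentiableOn.fun_sum fun j _ =>
      (hq1 j).sub <| DifferentiableOn.fun_sum fun m hm =>
        (differentiableOn_regularPart (hsing j m hm)).const_mul _
  · intro z hz h0
    have hz' := ball_inter_integerComplement hz h0
    simp only [bilateralMZV_eq_regularPart_add hw hz']
    rw [add_sub_assoc, ← Finset.sum_sub_distrib, add_right_inj]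
    refine Finset.sum_congr rfl fun j _ => ?_
    rw [hq3 j z, mul_add, ← mul_assoc, ← mul_pow, inv_mul_cancel₀ h0, one_pow, one_mul,
      add_comm, add_sub_assoc, sub_eq_add_neg (q j z), Finset.mul_sum, ← Finset.sum_sub_distrib,
      ← Finset.sum_neg_distrib, add_right_inj]
    refine Finset.sum_congr rfl fun m hm => ?_
    have hm' := Finset.mem_range.1 hm
    rw [bilateralMZV_singleton (by omega) hz']
    have : z⁻¹ ^ w.getD j 0 * z ^ m = z⁻¹ ^ (w.getD j 0 - m) := by
      conv_lhs => rw [← Nat.sub_add_cancel hm'.le, pow_add, mul_assoc, ← mul_pow,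
        inv_mul_cancel₀ h0, one_pow, mul_one]
    linear_combination taylorCoeff (polarPart T w j) m * this
  · exact hlim stripTop_le tendsto_pi_mul_cot_stripTop
  · exact hlim stripBot_le tendsto_pi_mul_cot_stripBot

end Identity

section TaylorCoefficients

open Filter Topology Metric

/-- `∑_{a₁+⋯+a_r=n} Φ(l₁+a₁,…,l_r+a_r) ∏ C(l_i-1+a_i,a_i)`. -/
def shiftedSum (Φ : List ℕ → ℂ) (n : ℕ) : List ℕ → ℂ
  | [] => if n = 0 then Φ [] else 0
  | k :: w => ∑ p ∈ Finset.HasAntidiagonal.antidiagonal n,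
      ((k - 1 + p.1).choose p.1 : ℂ) * shiftedSum (fun v => Φ ((k + p.1) :: v)) p.2 w

lemma sum_antidiagonalTuple_succ {r n : ℕ} (g : (Fin (r + 1) → ℕ) → ℂ) :
    ∑ f ∈ Finset.Nat.antidiagonalTuple (r + 1) n, g f =
      ∑ p ∈ Finset.HasAntidiagonal.antidiagonal n, ∑ f ∈ Finset.Nat.antidiagonalTuple r p.2,
        g (Fin.cons p.1 f) := by
  rw [Finset.sum_sigma']
  symm
  refine Finset.sum_bij' (fun x _ => Fin.cons x.1.1 x.2)
    (fun f _ => ⟨(f 0, ∑ i : Fin r, f i.succ), Fin.tail f⟩) ?_ ?_ ?_ ?_ ?_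
  · rintro ⟨⟨a, b⟩, f⟩ h
    simp only [Finset.mem_sigma, Finset.HasAntidiagonal.mem_antidiagonal, Finset.Nat.mem_antidiagonalTuple] at h ⊢
    simp [Fin.sum_univ_succ, h]
  · intro f h
    simp only [Finset.mem_sigma, Finset.HasAntidiagonal.mem_antidiagonal, Finset.Nat.mem_antidiagonalTuple] at h ⊢
    exact ⟨by rw [← h, Fin.sum_univ_succ], rfl⟩
  · rintro ⟨⟨a, b⟩, f⟩ h
    simp only [Finset.mem_sigma, Finset.HasAntidiagonal.mem_antidiagonal, Finset.Nat.mem_antidiagonalTuple] at h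
    simp [h.2]
  · intro f _
    exact Fin.cons_self_tail f
  · intro x _
    rfl

lemma shiftedSum_eq_sum (Φ : List ℕ → ℂ) (n : ℕ) (w : List ℕ) :
    shiftedSum Φ n w = ∑ f ∈ Finset.Nat.antidiagonalTuple w.length n,
      Φ (List.ofFn fun i => w.get i + f i) *
        ∏ i, (Nat.choose (w.get i - 1 + f i) (f i) : ℂ) := by
  induction w generalizing Φ n with
  | nil =>
    rcases n with _ | n
    · simp [shiftedSum]
    · simp [shiftedSum, Finset.Nat.antidiagonalTuple_zero_succ]
  | cons k w ih =>
    simp only [shiftedSum, ih, List.length_cons, sum_antidiagonalTuple_succ, Finset.mul_sum]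
    refine Finset.sum_congr rfl fun p _ => Finset.sum_congr rfl fun f _ => ?_
    rw [List.ofFn_succ, Fin.prod_univ_succ]
    simp only [Fin.cons_zero, Fin.cons_succ, List.get_eq_getElem, Fin.val_zero, Fin.val_succ,
      List.getElem_cons_zero, List.getElem_cons_succ]
    ring

lemma shiftedSum_ofReal (Z : List ℕ → ℝ) (a : ℕ) (l : List ℕ) :
    (-1) ^ a * shiftedSum (fun v => (Z v : ℂ)) a l = zetaA Z a l := by
  have h : (Fintype.piFinset fun _ : Fin l.length => Finset.range (a + 1)).filter
      (fun f => ∑ i, f i = a) = Finset.Nat.antidiagonalTuple l.length a := by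
    ext f
    simp only [Finset.mem_filter, Fintype.mem_piFinset, Finset.mem_range,
      Finset.Nat.mem_antidiagonalTuple, and_iff_right_iff_imp]
    intro hf i
    have := Finset.single_le_sum (f := f) (fun _ _ => Nat.zero_le _) (Finset.mem_univ i)
    omega
  rw [zetaA, h, shiftedSum_eq_sum]
  push_cast
  rfl

lemma sum_antidiagonal_euler (X : ℕ → ℕ → ℂ) (n : ℕ) :
    ∑ p ∈ Finset.HasAntidiagonal.antidiagonal n, ((p.1 + 1) * X (p.1 + 1) p.2 + (p.2 + 1) * X p.1 (p.2 + 1)) =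
      (n + 1) * ∑ p ∈ Finset.HasAntidiagonal.antidiagonal (n + 1), X p.1 p.2 := by
  have h : ∀ p ∈ Finset.HasAntidiagonal.antidiagonal (n + 1), ((n : ℂ) + 1) * X p.1 p.2 =
      p.1 * X p.1 p.2 + p.2 * X p.1 p.2 := fun p hp => by
    have : (p.1 : ℂ) + p.2 = n + 1 := by exact_mod_cast Finset.HasAntidiagonal.mem_antidiagonal.1 hp
    rw [← this]
    ring
  rw [Finset.mul_sum, Finset.sum_congr rfl h, Finset.sum_add_distrib, Finset.sum_add_distrib,
    Finset.Nat.sum_antidiagonal_succ, Finset.Nat.sum_antidiagonal_succ']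
  simp

lemma shiftedSum_add (Φ Ψ : List ℕ → ℂ) (n : ℕ) (w : List ℕ) :
    shiftedSum (fun v => Φ v + Ψ v) n w = shiftedSum Φ n w + shiftedSum Ψ n w := by
  simp only [shiftedSum_eq_sum, add_mul, Finset.sum_add_distrib]

lemma shiftedSum_const_mul (c : ℂ) (Φ : List ℕ → ℂ) (n : ℕ) (w : List ℕ) :
    shiftedSum (fun v => c * Φ v) n w = c * shiftedSum Φ n w := by
  simp only [shiftedSum_eq_sum, mul_assoc, Finset.mul_sum]

lemma shiftedSum_derivSum (Φ : List ℕ → ℂ) (n : ℕ) {w : List ℕ} (hw : PosWord w) :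
    shiftedSum (derivSum Φ) n w = (n + 1) * shiftedSum Φ (n + 1) w := by
  induction w generalizing Φ n with
  | nil => simp [shiftedSum, derivSum]
  | cons k w ih =>
    obtain ⟨hk, hw⟩ := posWord_cons.1 hw
    simp only [shiftedSum, derivSum, shiftedSum_add, shiftedSum_const_mul, ih _ _ hw]
    rw [← sum_antidiagonal_euler fun a b => ((k - 1 + a).choose a : ℂ) *
      shiftedSum (fun v => Φ ((k + a) :: v)) b w]
    refine Finset.sum_congr rfl fun p _ => ?_
    have h : ((k + p.1 : ℕ) : ℂ) * ((k - 1 + p.1).choose p.1 : ℂ) =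
        (p.1 + 1) * ((k - 1 + (p.1 + 1)).choose (p.1 + 1) : ℂ) := by
      have := Nat.add_one_mul_choose_eq (k - 1 + p.1) p.1
      rw [show k - 1 + p.1 + 1 = k + p.1 by omega] at this
      rw [show k - 1 + (p.1 + 1) = k + p.1 by omega, mul_comm ((p.1 : ℂ) + 1)]
      exact_mod_cast this
    rw [show k + p.1 + 1 = k + (p.1 + 1) by omega]
    linear_combination shiftedSum (fun v => Φ ((k + (p.1 + 1)) :: v)) p.2 w * h

lemma hasDerivAt_shiftedSum {Φ : ℂ → List ℕ → ℂ} {Ψ : List ℕ → ℂ} {z : ℂ}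
    (h : ∀ v, PosWord v → HasDerivAt (fun y => Φ y v) (Ψ v) z) (n : ℕ) {w : List ℕ}
    (hw : PosWord w) : HasDerivAt (fun y => shiftedSum (Φ y) n w) (shiftedSum Ψ n w) z := by
  simp only [shiftedSum_eq_sum]
  refine HasDerivAt.fun_sum fun f _ => (h _ ?_).mul_const _
  intro i hi
  obtain ⟨j, rfl⟩ := (List.mem_ofFn' _ _).1 hi
  exact Nat.add_pos_left (hw _ (List.get_mem _ _)) _

variable {T : ℂ}

lemma iteratedDeriv_shiftMZV {w : List ℕ} (hw : PosWord w) (n : ℕ) {z : ℂ}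
    (hz : z ∈ polesCompl) : iteratedDeriv n (shiftMZV T w) z =
      (-1) ^ n * n.factorial * shiftedSum (fun v => shiftMZV T v z) n w := by
  induction n generalizing z with
  | zero =>
    have : ∀ Φ : List ℕ → ℂ, shiftedSum Φ 0 w = Φ w := by
      clear hw
      induction w with
      | nil => simp [shiftedSum]
      | cons k w ih => intro Φ; simp [shiftedSum, ih]
    simp [this]
  | succ n ih =>
    have h := (hasDerivAt_shiftedSum (Φ := fun y v => shiftMZV T v y)
      (fun v hv => hasDerivAt_shiftMZV (T := T) hv hz) n hw).const_mul
      ((-1 : ℂ) ^ n * n.factorial)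
    have h1 : iteratedDeriv n (shiftMZV T w) =ᶠ[𝓝 z] fun y =>
        (-1) ^ n * n.factorial * shiftedSum (fun v => shiftMZV T v y) n w := by
      filter_upwards [isOpen_polesCompl.mem_nhds hz] with y hy using ih hy
    rw [iteratedDeriv_succ, h1.deriv_eq, h.deriv]
    have h2 : shiftedSum (fun v => -derivSum (fun v => shiftMZV T v z) v) n w =
        -((n + 1) * shiftedSum (fun v => shiftMZV T v z) (n + 1) w) := by
      rw [← shiftedSum_derivSum _ _ hw, ← neg_one_mul, ← shiftedSum_const_mul]
      simp only [neg_one_mul]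
    rw [h2, Nat.factorial_succ]
    push_cast
    ring

variable {Z : List ℕ → ℝ}

lemma shiftedSum_congr {Φ Ψ : List ℕ → ℂ} (h : ∀ v, PosWord v → Φ v = Ψ v) (n : ℕ)
    {w : List ℕ} (hw : PosWord w) : shiftedSum Φ n w = shiftedSum Ψ n w := by
  rw [shiftedSum_eq_sum, shiftedSum_eq_sum]
  refine Finset.sum_congr rfl fun f _ => ?_
  rw [h]
  intro i hi
  obtain ⟨j, rfl⟩ := (List.mem_ofFn' _ _).1 hi
  exact Nat.add_pos_left (hw _ (List.get_mem _ _)) _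

lemma taylorCoeff_shiftMZV (hZ : IsStuffleReg Z) {w : List ℕ} (hw : PosWord w) (a : ℕ) :
    taylorCoeff (shiftMZV (Z [1]) w) a = zetaA Z a w := by
  have h0 : (a.factorial : ℂ) ≠ 0 := by exact_mod_cast a.factorial_ne_zero
  rw [taylorCoeff, iteratedDeriv_shiftMZV hw a zero_mem_polesCompl, ← shiftedSum_ofReal,
    shiftedSum_congr (fun v hv => shiftMZV_zero hZ hv) a hw]
  field_simp

lemma taylorCoeff_reflMZV (hZ : IsStuffleReg Z) {u : List ℕ} (hu : PosWord u) (a : ℕ) :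
    taylorCoeff (reflMZV (Z [1]) u) a = (-1) ^ (u.sum + a) * zetaA Z a u.reverse := by
  have h : taylorCoeff (reflMZV (Z [1]) u) a =
      (-1) ^ (u.sum + a) * taylorCoeff (shiftMZV (Z [1]) u.reverse) a := by
    have : reflMZV (Z [1]) u = fun z => (-1) ^ u.sum * shiftMZV (Z [1]) u.reverse (-z) := rfl
    rw [taylorCoeff, taylorCoeff, this, iteratedDeriv_const_mul_field, iteratedDeriv_comp_neg,
      neg_zero, smul_eq_mul]
    ring
  rw [h, taylorCoeff_shiftMZV hZ hu.reverse]

lemma taylorCoeff_mul {f g : ℂ → ℂ} (hf : DifferentiableOn ℂ f (ball 0 1))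
    (hg : DifferentiableOn ℂ g (ball 0 1)) (n : ℕ) :
    taylorCoeff (fun z => f z * g z) n =
      ∑ i ∈ Finset.range (n + 1), taylorCoeff f i * taylorCoeff g (n - i) := by
  have hn : ball (0 : ℂ) 1 ∈ nhds 0 := ball_mem_nhds 0 one_pos
  have h := iteratedDeriv_mul (n := n) (hf.analyticAt hn).contDiffAt (hg.analyticAt hn).contDiffAt
  rw [taylorCoeff, show (fun z => f z * g z) = f * g from rfl, h, Finset.sum_div]
  refine Finset.sum_congr rfl fun i hi => ?_
  have hi := Finset.mem_range_succ_iff.1 hi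
  have h1 : (n.factorial : ℂ) ≠ 0 := by exact_mod_cast n.factorial_ne_zero
  have h2 : (i.factorial : ℂ) ≠ 0 := by exact_mod_cast i.factorial_ne_zero
  have h3 : ((n - i).factorial : ℂ) ≠ 0 := by exact_mod_cast (n - i).factorial_ne_zero
  have h4 : (n.choose i : ℂ) * i.factorial * (n - i).factorial = n.factorial := by
    exact_mod_cast Nat.choose_mul_factorial_mul_factorial hi
  rw [taylorCoeff, taylorCoeff, ← h4]
  have h5 : (n.choose i : ℂ) ≠ 0 := by exact_mod_cast (Nat.choose_pos hi).ne'
  field_simp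

lemma taylorCoeff_polarPart (hZ : IsStuffleReg Z) {w : List ℕ} (hw : PosWord w) (j n : ℕ) :
    taylorCoeff (polarPart (Z [1]) w j) n = ∑ a ∈ Finset.range (n + 1),
      (-1 : ℂ) ^ ((w.take j).sum + a) * zetaA Z a (w.take j).reverse *
        zetaA Z (n - a) (w.drop (j + 1)) := by
  refine (taylorCoeff_mul (differentiableOn_reflMZV (hw.take j) fun _ hz =>
    neg_mem_polesCompl_of_ball hz) ((differentiableOn_shiftMZV (hw.drop (j + 1))).mono
      ball_subset_polesCompl) n).trans ?_
  refine Finset.sum_congr rfl fun a _ => ?_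
  rw [taylorCoeff_reflMZV hZ (hw.take j), taylorCoeff_shiftMZV hZ (hw.drop _)]

/-- The Taylor coefficients of `π z cot (π z)`, up to the factor `(-1)^n`. -/
noncomputable def cotCoeff (n : ℕ) : ℝ :=
  if Even n then (-1) ^ (n / 2) * ((2 * π) ^ n * ((bernoulli n : ℚ) : ℝ) / n.factorial) else 0

lemma two_mul_apply_even (hZ : IsStuffleReg Z) {m : ℕ} (hm : m ≠ 0) :
    2 * Z [2 * m] = -cotCoeff (2 * m) := by
  have hw : PosWord [2 * m] := by simp [PosWord]; omega
  have h1 := shiftMZV_zero hZ hw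
  have h2 := shiftMZV_append_singleton (T := Z [1]) (w := []) (by simp [PosWord])
    (show 2 ≤ 2 * m by omega) zero_mem_polesCompl
  rw [List.nil_append, h1] at h2
  have h3 := (hasSum_nat_add_iff' 1).2 (hasSum_zeta_nat hm)
  have h4 : ((∑' n : ℕ, 1 / ((n + 1 : ℕ) : ℝ) ^ (2 * m) : ℝ) : ℂ) = Z [2 * m] := by
    rw [h2, Complex.ofReal_tsum]
    refine tsum_congr fun n => ?_
    simp [truncSum_nil]
  obtain ⟨m, rfl⟩ := Nat.exists_eq_add_one_of_ne_zero hm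
  rw [← Complex.ofReal_inj.1 h4, h3.tsum_eq, cotCoeff, if_pos (even_two_mul _),
    Nat.mul_div_cancel_left _ two_pos]
  simp only [Finset.range_one, Finset.sum_singleton, Nat.cast_zero]
  rw [zero_pow (by omega), div_zero, sub_zero, show 2 * (m + 1) - 1 = 2 * m + 1 by omega]
  ring

lemma regularPart_singleton_zero (hZ : IsStuffleReg Z) {n : ℕ} (hn : 0 < n) :
    regularPart (Z [1]) [n] 0 = -cotCoeff n := by
  have hw : PosWord [n] := by simpa [PosWord] using hn
  have h : regularPart (Z [1]) [n] 0 = (1 + (-1) ^ n) * Z [n] := by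
    simp only [regularPart, List.length_singleton, Finset.sum_range_succ, Finset.range_zero,
      Finset.sum_empty, zero_add, List.take_zero, List.drop_zero, List.take_one, List.drop_one,
      reflMZV, List.sum_nil, List.reverse_nil, shiftMZV_nil, neg_zero, shiftMZV_zero hZ hw]
    simp [shiftMZV_nil, shiftMZV_zero hZ hw]
    ring
  rw [h]
  rcases Nat.even_or_odd n with he | ho
  · obtain ⟨m, rfl⟩ := he
    rw [← two_mul] at hn ⊢
    have := two_mul_apply_even hZ (m := m) (by omega)
    rw [Even.neg_one_pow (even_two_mul m), one_add_one_eq_two, ← Complex.ofReal_neg, ← this]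
    push_cast
    ring
  · rw [Odd.neg_one_pow ho, cotCoeff, if_neg (Nat.not_even_iff_odd.2 ho)]
    simp

lemma expOnes_add_expOnes_neg (w : List ℕ) :
    (expOnes (π * Complex.I) w + expOnes (-(π * Complex.I)) w) / 2 = deltaVal w := by
  have hall : (∀ i ∈ w, i = 1) ↔ w.all (· = 1) = true := by simp
  by_cases h : ∀ i ∈ w, i = 1
  · simp only [expOnes, onesFun, if_pos h, deltaVal, hall.1 h, true_and]
    rw [neg_pow]
    rcases Nat.even_or_odd w.length with he | ho
    · rw [if_pos (Nat.even_iff.1 he), he.neg_one_pow]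
      obtain ⟨m, hm⟩ := he
      rw [hm, ← two_mul, Nat.mul_div_cancel_left _ two_pos, mul_pow, pow_mul Complex.I,
        Complex.I_sq]
      push_cast
      ring
    · rw [if_neg (by simp [Nat.odd_iff.1 ho]), ho.neg_one_pow]
      simp [neg_div]
  · simp only [expOnes, onesFun, if_neg h, deltaVal, hall.not.1 h]
    simp

lemma sum_range_succ_cotCoeff (X : ℕ → ℝ) (k : ℕ) :
    ∑ n ∈ Finset.range (k + 1), X n * cotCoeff (k - n) =
      ∑ m ∈ Finset.range (k / 2 + 1), X (k - 2 * m) *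
        ((-1) ^ m * ((2 * π) ^ (2 * m) * ((bernoulli (2 * m) : ℚ) : ℝ) / (2 * m).factorial)) := by
  rw [← Finset.sum_flip]
  have h1 : ∀ n ∈ Finset.range (k + 1), X (k - n) * cotCoeff (k - (k - n)) =
      X (k - n) * cotCoeff n := fun n hn => by
    rw [Nat.sub_sub_self (Finset.mem_range_succ_iff.1 hn)]
  rw [Finset.sum_congr rfl h1]
  symm
  refine Finset.sum_of_injOn (fun m => 2 * m) (fun a _ b _ h => by simpa using h) ?_ ?_ ?_
  · intro m hm
    have := Finset.mem_range.1 hm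
    simp only [Finset.coe_range, Set.mem_Iio]
    omega
  · intro n hn hne
    have hodd : ¬Even n := fun ⟨m, hm⟩ => hne ⟨m, by
      have := Finset.mem_range.1 hn
      simp only [Finset.coe_range, Set.mem_Iio]
      omega, by simp only; omega⟩
    rw [cotCoeff, if_neg hodd, mul_zero]
  · intro m _
    rw [cotCoeff, if_pos (even_two_mul m), Nat.mul_div_cancel_left _ two_pos]

/-- The reflection relation between regularized multiple zeta values. -/
lemma sum_take_reverse_mul_drop (hZ : IsStuffleReg Z) {w : List ℕ} (hw : PosWord w) :
    ∑ i ∈ Finset.range (w.length + 1),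
        (-1 : ℝ) ^ (w.take i).sum * Z (w.take i).reverse * Z (w.drop i) =
      deltaVal w - ∑ j ∈ Finset.range w.length, ∑ m ∈ Finset.range (w.getD j 0 / 2 + 1),
        (∑ a ∈ Finset.range (w.getD j 0 - 2 * m + 1),
          (-1 : ℝ) ^ ((w.take j).sum + a) * zetaA Z a (w.take j).reverse *
            zetaA Z (w.getD j 0 - 2 * m - a) (w.drop (j + 1))) *
          ((-1) ^ m * ((2 * π) ^ (2 * m) * ((bernoulli (2 * m) : ℚ) : ℝ) /
            (2 * m).factorial)) := by
  have h := regularPart_zero (T := Z [1]) hw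
  have h1 : regularPart (Z [1]) w 0 = ∑ i ∈ Finset.range (w.length + 1),
      (-1 : ℂ) ^ (w.take i).sum * Z (w.take i).reverse * Z (w.drop i) :=
    Finset.sum_congr rfl fun i _ => by
      rw [reflMZV, neg_zero, shiftMZV_zero hZ (hw.take i).reverse, shiftMZV_zero hZ (hw.drop i)]
  rw [h1, expOnes_add_expOnes_neg, ← sub_neg_eq_add, ← Finset.sum_neg_distrib] at h
  rw [← Complex.ofReal_inj]
  push_cast
  refine h.trans ?_
  rw [sub_right_inj]
  refine Finset.sum_congr rfl fun j _ => ?_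
  have h2 := congrArg (fun x : ℝ => (x : ℂ)) (sum_range_succ_cotCoeff (fun n =>
    ∑ a ∈ Finset.range (n + 1), (-1 : ℝ) ^ ((w.take j).sum + a) * zetaA Z a (w.take j).reverse *
      zetaA Z (n - a) (w.drop (j + 1))) (w.getD j 0))
  push_cast at h2
  refine Eq.trans ?_ h2
  rw [Finset.sum_range_succ, neg_sub, sub_eq_neg_add, ← Finset.sum_neg_distrib,
    taylorCoeff_polarPart hZ hw]
  have h3 : cotCoeff 0 = 1 := by simp [cotCoeff]
  rw [Nat.sub_self, h3, Complex.ofReal_one, mul_one, add_left_inj]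
  refine Finset.sum_congr rfl fun m hm => ?_
  have hm := Finset.mem_range.1 hm
  rw [regularPart_singleton_zero hZ (by omega), taylorCoeff_polarPart hZ hw]
  ring

end TaylorCoefficients

section Antipode

/-- The convolution of two functions on words with respect to deconcatenation. -/
def wordConv (f g : List ℕ → ℝ) : List ℕ → ℝ
  | [] => f [] * g []
  | a :: w => f [] * g (a :: w) + wordConv (fun v => f (a :: v)) g w

lemma wordConv_eq_sum (f g : List ℕ → ℝ) (w : List ℕ) :
    wordConv f g w = ∑ i ∈ Finset.range (w.length + 1), f (w.take i) * g (w.drop i) := by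
  induction w generalizing f with
  | nil => simp [wordConv]
  | cons a w ih =>
    rw [wordConv, ih, List.length_cons, Finset.sum_range_succ' (n := w.length + 1), add_comm]
    simp

lemma wordConv_mul_add (c : ℝ) (f f' g : List ℕ → ℝ) (w : List ℕ) :
    wordConv (fun v => c * f v + f' v) g w = c * wordConv f g w + wordConv f' g w := by
  simp only [wordConv_eq_sum, add_mul, Finset.sum_add_distrib, Finset.mul_sum, mul_assoc]

lemma wordConv_assoc (f g h : List ℕ → ℝ) (w : List ℕ) :
    wordConv (wordConv f g) h w = wordConv f (wordConv g h) w := by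
  induction w generalizing f g with
  | nil => simp [wordConv, mul_assoc]
  | cons a w ih =>
    have e : (fun v => wordConv f g (a :: v)) =
        fun v => f [] * g (a :: v) + wordConv (fun v => f (a :: v)) g v := rfl
    rw [wordConv, wordConv, e, wordConv_mul_add, ih, wordConv.eq_2 f, wordConv.eq_2 g]
    ring

/-- The counit of the deconcatenation coproduct. -/
def wordCounit (w : List ℕ) : ℝ := if w = [] then 1 else 0

lemma wordConv_congr {f f' g g' : List ℕ → ℝ} (hf : ∀ v, PosWord v → f v = f' v)
    (hg : ∀ v, PosWord v → g v = g' v) {w : List ℕ} (hw : PosWord w) :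
    wordConv f g w = wordConv f' g' w := by
  rw [wordConv_eq_sum, wordConv_eq_sum]
  exact Finset.sum_congr rfl fun i _ => by rw [hf _ (hw.take i), hg _ (hw.drop i)]

lemma wordConv_wordCounit (f : List ℕ → ℝ) (w : List ℕ) : wordConv f wordCounit w = f w := by
  induction w generalizing f with
  | nil => simp [wordConv, wordCounit]
  | cons a w ih => simp [wordConv, ih, wordCounit]

lemma wordCounit_wordConv (g : List ℕ → ℝ) (w : List ℕ) : wordConv wordCounit g w = g w := by
  rw [wordConv_eq_sum, Finset.sum_eq_single 0]
  · simp [wordCounit]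
  · intro i hi h0
    rw [wordCounit, if_neg, zero_mul]
    rw [List.take_eq_nil_iff]
    rintro (h | rfl)
    · exact h0 h
    · simp at hi
      omega
  · simp

lemma eq_wordCounit_of_wordConv_eq {f e : List ℕ → ℝ} (hf : f [] = 1)
    (h : ∀ w, PosWord w → wordConv f e w = f w) {w : List ℕ} (hw : PosWord w) :
    e w = wordCounit w := by
  induction hn : w.length using Nat.strong_induction_on generalizing w with
  | _ n ih =>
    cases w with
    | nil => simpa [wordConv, hf, wordCounit] using h [] hw
    | cons a w =>
      have h1 := h _ hw
      have h2 : wordConv (fun v => f (a :: v)) e w =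
          wordConv (fun v => f (a :: v)) wordCounit w := by
        rw [wordConv_eq_sum, wordConv_eq_sum]
        refine Finset.sum_congr rfl fun i _ => ?_
        rw [ih (w.drop i).length _ ((posWord_cons.1 hw).2.drop i) rfl]
        simp only [List.length_drop, List.length_cons] at hn ⊢
        omega
      rw [wordConv, h2, wordConv_wordCounit, hf] at h1
      rw [wordCounit, if_neg (by simp)]
      linarith

lemma contractions_cons_cons (a b : ℕ) (t : List ℕ) :
    contractions (a :: b :: t) =
      (contractions (b :: t)).map (a :: ·) + contractions ((a + b) :: t) := by
  rw [contractions]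

/-- Add a number to the first letter of a nonempty word. -/
def addHead (b : ℕ) : List ℕ → List ℕ
  | [] => []
  | h :: c => (b + h) :: c

lemma contractions_add_cons (b a : ℕ) (t : List ℕ) :
    contractions ((b + a) :: t) = (contractions (a :: t)).map (addHead b) := by
  induction t generalizing a with
  | nil => simp [contractions, addHead]
  | cons c t ih =>
    rw [contractions_cons_cons, contractions_cons_cons, Multiset.map_add, add_assoc, ih,
      Multiset.map_map]
    rfl

lemma mem_contractions_cons {a : ℕ} {t c : List ℕ} (hc : c ∈ contractions (a :: t)) :
    ∃ h c', c = h :: c' := by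
  induction t generalizing a with
  | nil => exact ⟨a, [], by simpa [contractions] using hc⟩
  | cons b t ih =>
    rw [contractions_cons_cons, Multiset.mem_add, Multiset.mem_map] at hc
    rcases hc with ⟨x, _, rfl⟩ | hc
    · exact ⟨_, _, rfl⟩
    · exact ih hc

lemma posWord_of_mem_contractions {p c : List ℕ} (hp : PosWord p) (hc : c ∈ contractions p) :
    PosWord c := by
  cases p with
  | nil =>
    rw [contractions, Multiset.mem_singleton] at hc
    exact hc ▸ hp
  | cons a t =>
    induction t generalizing a c with
    | nil =>
      rw [contractions, Multiset.mem_singleton] at hc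
      exact hc ▸ hp
    | cons b t ih =>
      obtain ⟨ha, hbt⟩ := posWord_cons.1 hp
      obtain ⟨hb, ht⟩ := posWord_cons.1 hbt
      rw [contractions_cons_cons, Multiset.mem_add, Multiset.mem_map] at hc
      rcases hc with ⟨x, hx, rfl⟩ | hc
      · exact posWord_cons.2 ⟨ha, ih b hbt hx⟩
      · exact ih (a + b) (posWord_cons.2 ⟨by omega, ht⟩) hc

/-- The part of `stuffleSum Φ c q` in which the first letter of `c` stands in front. -/
def headTerm (Φ : List ℕ → ℝ) (q : List ℕ) : List ℕ → ℝ
  | [] => 0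
  | h :: c => stuffleSum (fun w => Φ (h :: w)) c q

/-- The sum of `headTerm` over all contractions of `p`. -/
def headSum (Φ : List ℕ → ℝ) (p q : List ℕ) : ℝ :=
  ((contractions p).map (headTerm Φ q)).sum

lemma sum_contractions_stuffleSum_cons (Φ : List ℕ → ℝ) (p : List ℕ) (b : ℕ) (q : List ℕ) :
    ((contractions p).map fun c => stuffleSum Φ c (b :: q)).sum =
      headSum Φ p (b :: q) + headSum Φ (b :: p) q := by
  cases p with
  | nil => simp [headSum, contractions, headTerm]
  | cons a t =>
    rw [headSum, headSum, contractions_cons_cons, Multiset.map_add, Multiset.sum_add,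
      contractions_add_cons, Multiset.map_map, Multiset.map_map, ← Multiset.sum_map_add,
      ← Multiset.sum_map_add]
    refine congrArg Multiset.sum (Multiset.map_congr rfl fun c hc => ?_)
    obtain ⟨h, c, rfl⟩ := mem_contractions_cons hc
    rw [stuffleSum_cons_cons, add_assoc, add_comm h b]
    rfl

lemma sum_contractions_stuffleSum_nil (Φ : List ℕ → ℝ) (a : ℕ) (t : List ℕ) :
    ((contractions (a :: t)).map fun c => stuffleSum Φ c []).sum = headSum Φ (a :: t) [] := by
  refine congrArg Multiset.sum (Multiset.map_congr rfl fun c hc => ?_)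
  obtain ⟨h, c, rfl⟩ := mem_contractions_cons hc
  simp [headTerm]

variable {Z : List ℕ → ℝ}

lemma IsStuffleReg.zetaStarOf_mul (hZ : IsStuffleReg Z) {p q : List ℕ} (hp : PosWord p)
    (hq : PosWord q) :
    zetaStarOf Z p * Z q = ((contractions p).map fun c => stuffleSum Z c q).sum := by
  rw [zetaStarOf, ← Multiset.sum_map_mul_right]
  exact congrArg Multiset.sum (Multiset.map_congr rfl fun c hc =>
    hZ.mul c q (posWord_of_mem_contractions hp hc) hq)

lemma IsStuffleReg.wordConv_zetaStarOf_append (hZ : IsStuffleReg Z) {p q : List ℕ}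
    (hp : PosWord p) (hq : PosWord q) :
    wordConv (fun u => (-1) ^ u.length * zetaStarOf Z (u.reverse ++ p)) Z q =
      if p = [] ∧ q = [] then 1 else headSum Z p q := by
  induction q generalizing p with
  | nil =>
    cases p with
    | nil => simp [wordConv, zetaStarOf, contractions, hZ.empty]
    | cons a t =>
      rw [← sum_contractions_stuffleSum_nil, ← hZ.zetaStarOf_mul hp hq]
      simp [wordConv]
  | cons b q ih =>
    obtain ⟨hb, hq'⟩ := posWord_cons.1 hq
    have h1 := ih (posWord_cons.2 ⟨hb, hp⟩) hq'
    have h2 := wordConv_mul_add (-1)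
      (fun u => (-1) ^ u.length * zetaStarOf Z (u.reverse ++ b :: p)) (fun _ => 0) Z q
    have h3 := (hZ.zetaStarOf_mul hp hq).trans (sum_contractions_stuffleSum_cons Z p b q)
    have h4 : wordConv (fun _ => 0) Z q = 0 := by simp [wordConv_eq_sum]
    have h5 : (fun v : List ℕ => (-1 : ℝ) ^ (b :: v).length *
        zetaStarOf Z ((b :: v).reverse ++ p)) = fun u =>
        -1 * ((-1) ^ u.length * zetaStarOf Z (u.reverse ++ b :: p)) + 0 := by
      funext v
      simp [pow_succ]
    rw [if_neg (by simp)] at h1 ⊢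
    rw [wordConv, h5, h2, h1, h4]
    simp only [List.length_nil, pow_zero, one_mul, List.reverse_nil, List.nil_append]
    linarith

lemma IsStuffleReg.wordConv_zetaStarOf_reverse (hZ : IsStuffleReg Z) {w : List ℕ}
    (hw : PosWord w) :
    wordConv (fun u => (-1) ^ u.length * zetaStarOf Z u.reverse) Z w = wordCounit w := by
  have h := hZ.wordConv_zetaStarOf_append (p := []) (by simp [PosWord]) hw
  simpa [headSum, contractions, headTerm, wordCounit] using h

lemma IsStuffleReg.wordConv_reverse_zetaStarOf (hZ : IsStuffleReg Z) {w : List ℕ}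
    (hw : PosWord w) :
    wordConv Z (fun u => (-1) ^ u.length * zetaStarOf Z u.reverse) w = wordCounit w := by
  refine eq_wordCounit_of_wordConv_eq
    (f := fun u => (-1) ^ u.length * zetaStarOf Z u.reverse)
    (by simp [zetaStarOf, contractions, hZ.empty]) (fun v hv => ?_) hw
  rw [← wordConv_assoc,
    wordConv_congr (fun v hv => hZ.wordConv_zetaStarOf_reverse hv) (fun _ _ => rfl) hv,
    wordCounit_wordConv]

lemma wordConv_reverse (f g : List ℕ → ℝ) (w : List ℕ) :
    wordConv f g w.reverse = wordConv (fun u => g u.reverse) (fun u => f u.reverse) w := by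
  rw [wordConv_eq_sum, wordConv_eq_sum, ← Finset.sum_range_reflect, List.length_reverse]
  refine Finset.sum_congr rfl fun i hi => ?_
  rw [List.reverse_take, List.reverse_drop, mul_comm]
  congr 2

/-- The antipode relation between `zetaStarOf Z` and `Z`. -/
theorem IsStuffleReg.wordConv_zetaStarOf (hZ : IsStuffleReg Z) {w : List ℕ} (hw : PosWord w) :
    wordConv (fun u => (-1) ^ u.length * zetaStarOf Z u) (fun u => Z u.reverse) w =
      wordCounit w := by
  have h := hZ.wordConv_reverse_zetaStarOf hw.reverse
  rw [wordConv_reverse] at h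
  simpa [wordCounit] using h

end Antipode

section MainIdentity

variable {Z : List ℕ → ℝ}

lemma neg_one_pow_sum_mul_deltaVal (w : List ℕ) :
    (-1 : ℝ) ^ w.sum * deltaVal w = deltaVal w := by
  rw [deltaVal]
  split_ifs with h
  · have h1 : w = List.replicate w.length 1 :=
      List.eq_replicate_iff.2 ⟨rfl, fun b hb => by simpa using List.all_eq_true.1 h.1 b hb⟩
    have h2 : w.sum = w.length := by
      conv_lhs => rw [h1]
      simp
    rw [h2, (Nat.even_iff.2 h.2).neg_one_pow, one_mul]
  · simp

/-- The contribution of the letter `n` of the word `u ++ n :: v` to the reversal relation. -/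
noncomputable def bernoulliTerm (Z : List ℕ → ℝ) (u : List ℕ) (n : ℕ) (v : List ℕ) : ℝ :=
  ∑ m ∈ Finset.range (n / 2 + 1), ∑ a ∈ Finset.range (n - 2 * m + 1),
    (-1 : ℝ) ^ ((n - 2 * m - a) + v.sum + m) *
      ((2 * π) ^ (2 * m) * ((bernoulli (2 * m) : ℚ) : ℝ) / Nat.factorial (2 * m)) *
      zetaA Z a u.reverse * zetaA Z (n - 2 * m - a) v

lemma neg_one_pow_mul_neg_one_pow {p q r t : ℕ} (h : p + q = r + 2 * t) :
    (-1 : ℝ) ^ p * (-1) ^ q = (-1) ^ r := by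
  rw [← pow_add, h, pow_add, pow_mul]
  simp

lemma IsStuffleReg.wordConv_reverse (hZ : IsStuffleReg Z) {w : List ℕ} (hw : PosWord w) :
    wordConv (fun u => Z u.reverse) (fun u => (-1) ^ u.sum * Z u) w =
      deltaVal w - ∑ j ∈ Finset.range w.length,
        bernoulliTerm Z (w.take j) (w.getD j 0) (w.drop (j + 1)) := by
  have h := congrArg (fun x => (-1 : ℝ) ^ w.sum * x) (sum_take_reverse_mul_drop hZ hw)
  simp only [mul_sub, neg_one_pow_sum_mul_deltaVal, Finset.mul_sum] at h
  rw [wordConv_eq_sum]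
  refine (Eq.trans ?_ h).trans (congrArg (deltaVal w - ·) ?_)
  · refine Finset.sum_congr rfl fun i _ => ?_
    have e := List.sum_take_add_sum_drop w i
    rw [← neg_one_pow_mul_neg_one_pow (p := w.sum) (q := (w.take i).sum)
      (r := (w.drop i).sum) (t := (w.take i).sum) (by omega)]
    ring
  · refine Finset.sum_congr rfl fun j hj => ?_
    rw [bernoulliTerm]
    refine Finset.sum_congr rfl fun m hm => ?_
    rw [Finset.sum_mul, Finset.mul_sum]
    refine Finset.sum_congr rfl fun a ha => ?_
    rw [Finset.mem_range] at hj hm ha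
    have e1 := List.sum_take_add_sum_drop w j
    have e2 : (w.drop j).sum = w.getD j 0 + (w.drop (j + 1)).sum := by
      rw [List.drop_eq_getElem_cons hj, List.sum_cons, List.getD_eq_getElem _ _ hj]
    rw [pow_add _ (w.getD j 0 - 2 * m - a + (w.drop (j + 1)).sum),
      ← neg_one_pow_mul_neg_one_pow (p := w.sum) (q := (w.take j).sum + a)
      (r := w.getD j 0 - 2 * m - a + (w.drop (j + 1)).sum)
      (t := (w.take j).sum + a + m) (by omega)]
    ring

lemma sum_range_sum_range_sub (d : ℕ) (F : ℕ → ℕ → ℝ) :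
    ∑ i ∈ Finset.range (d + 1), ∑ j ∈ Finset.range (d - i), F i (i + j + 1) =
      ∑ j ∈ Finset.Icc 1 d, ∑ i ∈ Finset.range j, F i j := by
  rw [Finset.sum_sigma', Finset.sum_sigma']
  refine Finset.sum_bij' (fun x _ => ⟨x.1 + x.2 + 1, x.1⟩) (fun x _ => ⟨x.2, x.1 - x.2 - 1⟩)
    ?_ ?_ ?_ ?_ ?_
  · rintro ⟨i, j⟩ h
    simp only [Finset.mem_sigma, Finset.mem_range, Finset.mem_Icc] at h ⊢
    omega
  · rintro ⟨j, i⟩ h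
    simp only [Finset.mem_sigma, Finset.mem_range, Finset.mem_Icc] at h ⊢
    omega
  · rintro ⟨i, j⟩ _
    simp only [Sigma.mk.injEq, heq_eq_eq, true_and]
    omega
  · rintro ⟨j, i⟩ h
    simp only [Finset.mem_sigma, Finset.mem_range, Finset.mem_Icc] at h
    simp only [Sigma.mk.injEq, heq_eq_eq, and_true]
    omega
  · rintro ⟨i, j⟩ _
    rfl

lemma IsStuffleReg.neg_one_pow_sum_mul (hZ : IsStuffleReg Z) {k : List ℕ} (hk : PosWord k) :
    (-1) ^ k.sum * Z k =
      ∑ i ∈ Finset.range (k.length + 1),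
        (-1) ^ i * zetaStarOf Z (k.take i) * deltaVal (k.drop i) -
      ∑ j ∈ Finset.Icc 1 k.length, ∑ i ∈ Finset.range j,
        (-1) ^ i * zetaStarOf Z (k.take i) *
          bernoulliTerm Z ((k.take (j - 1)).drop i) (k.getD (j - 1) 0) (k.drop j) := by
  have h := wordConv_assoc (fun u => (-1) ^ u.length * zetaStarOf Z u) (fun u => Z u.reverse)
    (fun u => (-1) ^ u.sum * Z u) k
  rw [wordConv_congr (fun v hv => hZ.wordConv_zetaStarOf hv) (fun _ _ => rfl) hk,
    wordCounit_wordConv,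
    wordConv_congr (fun _ _ => rfl) (fun v hv => hZ.wordConv_reverse hv) hk,
    wordConv_eq_sum] at h
  rw [h, ← sum_range_sum_range_sub k.length (fun i j => (-1) ^ i * zetaStarOf Z (k.take i) *
    bernoulliTerm Z ((k.take (j - 1)).drop i) (k.getD (j - 1) 0) (k.drop j)),
    ← Finset.sum_sub_distrib]
  refine Finset.sum_congr rfl fun i hi => ?_
  have hi' : (k.take i).length = i :=
    List.length_take_of_le (Nat.lt_succ_iff.1 (Finset.mem_range.1 hi))
  rw [hi', mul_sub, Finset.mul_sum, List.length_drop]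
  congr 1
  refine Finset.sum_congr rfl fun j _ => ?_
  rw [List.drop_drop, Nat.add_sub_cancel, List.drop_take, Nat.add_sub_cancel_left, ← add_assoc]
  simp only [List.getD_eq_getElem?_getD, List.getElem?_drop]

end MainIdentity

/-- Theorem (main2 of the paper): for positive integers `k₁,…,k_d`,
`(-1)^d ζ^{⋆,*}(k₁,…,k_d) − (-1)^{k₁+⋯+k_d} ζ^*(k₁,…,k_d)
 = −∑_{i=0}^{d-1} (-1)^i ζ^{⋆,*}(k₁,…,k_i) δ^{k_{i+1},…,k_d}
   + ∑_{0≤i<j≤d} ∑_{a+2m+b=k_j} (-1)^{i+b+k_{j+1}+⋯+k_d+m} (2π)^{2m} B_{2m}/(2m)!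
       ζ^{⋆,*}(k₁,…,k_i) ζ_a^*(k_{j-1},…,k_{i+1}) ζ_b^*(k_{j+1},…,k_d)`. -/
theorem main_identity (Z : List ℕ → ℝ) (hZ : IsStuffleReg Z)
    (k : List ℕ) (hk : ∀ i ∈ k, 0 < i) :
    (-1 : ℝ) ^ k.length * zetaStarOf Z k - (-1 : ℝ) ^ k.sum * Z k =
      -(∑ i ∈ Finset.range k.length,
          (-1 : ℝ) ^ i * zetaStarOf Z (k.take i) * deltaVal (k.drop i)) +
      ∑ j ∈ Finset.Icc 1 k.length, ∑ i ∈ Finset.range j,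
        ∑ m ∈ Finset.range (k.getD (j - 1) 0 / 2 + 1),
          ∑ a ∈ Finset.range (k.getD (j - 1) 0 - 2 * m + 1),
            (-1 : ℝ) ^ (i + (k.getD (j - 1) 0 - 2 * m - a) + (k.drop j).sum + m) *
              ((2 * π) ^ (2 * m) * ((bernoulli (2 * m) : ℚ) : ℝ) /
                Nat.factorial (2 * m)) *
              zetaStarOf Z (k.take i) *
              zetaA Z a (((k.take (j - 1)).drop i).reverse) *
              zetaA Z (k.getD (j - 1) 0 - 2 * m - a) (k.drop j) := by
  have h := hZ.neg_one_pow_sum_mul hk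
  rw [Finset.sum_range_succ, List.take_length, List.drop_length] at h
  have h1 : deltaVal [] = 1 := by simp [deltaVal]
  rw [h, h1, mul_one]
  simp only [bernoulliTerm, Finset.mul_sum]
  have e : ∀ x y z w : ℝ, z = w → x - (y + x - z) = -y + w := by
    rintro x y z _ rfl
    ring
  refine e _ _ _ _ (Finset.sum_congr rfl fun j _ => Finset.sum_congr rfl fun i _ =>
    Finset.sum_congr rfl fun m _ => Finset.sum_congr rfl fun a _ => ?_)
  rw [add_assoc i, add_assoc i, pow_add _ i]
  ring
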